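/- arXiv:1504.00326 — 14 statements merged into one kernel-verified Lean document; each statement's English description precedes it below -/
import Mathlib

section
/- Let p be an odd prime, let k ≥ 0 be a natural number, and let θ and θ' be units of the ring ℤ_p of p-adic integers. Then the 2×2 diagonal matrices diag(θ·p^k, θ·p^k) and diag(θ'·p^k, θ'·p^k) are congruent over ℤ_p; that is, there exists a 2×2 matrix P over ℤ_p whose determinant is a unit of ℤ_p with Pᵀ · diag(θ·p^k, θ·p^k) · P = diag(θ'·p^k, θ'·p^k). -/
open Polynomial in
/-- In a Henselian ring, an element congruent modulo `I` to the square of a unit `a`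
is itself a square, provided `2` is a unit. -/
theorem HenselianRing.isSquare_of_sq_sub_mem {R : Type*} [CommRing R] {I : Ideal R}
    [HenselianRing R I] {a c : R} (h2 : IsUnit (2 : R)) (ha : IsUnit a)
    (h : a ^ 2 - c ∈ I) : IsSquare c := by
  obtain ⟨x, hx, -⟩ := HenselianRing.is_henselian (I := I) (X ^ 2 - C c)
    (monic_X_pow_sub_C c two_ne_zero) a (by simpa using h)
    (by simpa [one_add_one_eq_two] using (h2.mul ha).map (Ideal.Quotient.mk I))
  refine ⟨x, ?_⟩
  have hx' : x ^ 2 - c = 0 := by simpa [IsRoot] using hx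
  linear_combination -hx'

namespace PadicInt

variable {p : ℕ} [Fact p.Prime]

theorem isUnit_iff_toZMod_ne_zero {x : ℤ_[p]} : IsUnit x ↔ toZMod x ≠ 0 := by
  rw [ne_eq, ← RingHom.mem_ker, ker_toZMod, IsLocalRing.mem_maximalIdeal, mem_nonunits_iff,
    not_not]

theorem isUnit_two (hp : p ≠ 2) : IsUnit (2 : ℤ_[p]) := by
  have : Fact (2 < p) := ⟨(Fact.out : p.Prime).two_le.lt_of_ne hp.symm⟩
  rw [isUnit_iff_toZMod_ne_zero, map_ofNat]
  exact Ring.two_ne_zero (by rwa [ZMod.ringChar_zmod_n])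

/-- For odd `p`, every `p`-adic unit is a sum of two squares of `p`-adic integers. -/
theorem exists_sq_add_sq_eq_unit (hp : p ≠ 2) (u : ℤ_[p]ˣ) :
    ∃ a b : ℤ_[p], a ^ 2 + b ^ 2 = u := by
  obtain ⟨x, y, hxy⟩ := ZMod.sq_add_sq p (toZMod (u : ℤ_[p]))
  have hu : toZMod (u : ℤ_[p]) ≠ 0 := isUnit_iff_toZMod_ne_zero.mp u.isUnit
  wlog hx : x ≠ 0 generalizing x y
  · refine this y x (by rw [add_comm, hxy]) fun hy => hu ?_
    rw [← hxy, hy, not_not.mp hx]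
    ring
  obtain ⟨a, rfl⟩ := ZMod.ringHom_surjective (toZMod (p := p)) x
  obtain ⟨b, rfl⟩ := ZMod.ringHom_surjective (toZMod (p := p)) y
  obtain ⟨z, hz⟩ := HenselianRing.isSquare_of_sq_sub_mem (I := IsLocalRing.maximalIdeal ℤ_[p])
    (c := u - b ^ 2) (isUnit_two hp) (isUnit_iff_toZMod_ne_zero.mpr hx) (by
      rw [← ker_toZMod, RingHom.mem_ker]
      simp only [map_sub, map_pow]
      linear_combination hxy)
  exact ⟨z, b, by linear_combination -hz⟩

end PadicInt


/-- Relation (a): `2K_θ^{(p)}(p^k) ≅ 2K_{θ'}^{(p)}(p^k)` for odd primes `p`. -/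
theorem relation_a (p : ℕ) [Fact p.Prime] (hp : p ≠ 2) (k : ℕ) (θ θ' : (PadicInt p)ˣ) :
    ∃ P : Matrix (Fin 2) (Fin 2) (PadicInt p), IsUnit P.det ∧
      P.transpose *
          Matrix.diagonal ![(θ : PadicInt p) * (p : PadicInt p) ^ k,
            (θ : PadicInt p) * (p : PadicInt p) ^ k] * P =
        Matrix.diagonal ![(θ' : PadicInt p) * (p : PadicInt p) ^ k,
          (θ' : PadicInt p) * (p : PadicInt p) ^ k] := by
  obtain ⟨a, b, hab⟩ := PadicInt.exists_sq_add_sq_eq_unit hp (θ⁻¹ * θ')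
  have hθ : (θ : PadicInt p) * (a ^ 2 + b ^ 2) = θ' := by simp [hab]
  refine ⟨!![a, -b; b, a], ?_, ?_⟩
  · have hdet : !![a, -b; b, a].det = ((θ⁻¹ * θ' : (PadicInt p)ˣ) : PadicInt p) := by
      rw [Matrix.det_fin_two_of, ← hab]
      ring
    exact hdet ▸ Units.isUnit _
  · rw [← hθ]
    ext i j
    fin_cases i <;> fin_cases j <;>
      simp [Matrix.mul_apply, Fin.sum_univ_two, Matrix.diagonal] <;> ring
end

section
/- Let k ≥ 0 be a natural number. Over the ring ℤ_2 of 2-adic integers, the 4×4 block-diagonal matrix U(2^k) ⊕ U(2^k) is congruent over ℤ_2 to the 4×4 block-diagonal matrix V(2^k) ⊕ V(2^k). -/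
/-- The 2-adic matrix `U(2^k) = [[0, 2^k], [2^k, 0]]`. -/
noncomputable def U2 (k : ℕ) : Matrix (Fin 2) (Fin 2) (PadicInt 2) :=
  !![0, 2 ^ k; 2 ^ k, 0]

/-- The 2-adic matrix `V(2^k) = [[2^(k+1), 2^k], [2^k, 2^(k+1)]]`. -/
noncomputable def V2 (k : ℕ) : Matrix (Fin 2) (Fin 2) (PadicInt 2) :=
  !![2 ^ (k + 1), 2 ^ k; 2 ^ k, 2 ^ (k + 1)]

/-- The polynomial `X ^ 2 + X + 2` has a root in `ℤ_2`. -/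
theorem exists_sq_add_self_add_two_eq_zero : ∃ c : PadicInt 2, c ^ 2 + c + 2 = 0 := by
  obtain ⟨c, hc, -⟩ := hensels_lemma (p := 2) (R := PadicInt 2)
    (F := Polynomial.X ^ 2 + Polynomial.X + 2) (a := 0) (by
      have h : ‖(2 : PadicInt 2)‖ < 1 := by
        simpa using (PadicInt.norm_int_lt_one_iff_dvd (p := 2) 2).2 (by norm_num)
      simpa using h)
  exact ⟨c, by simpa using hc⟩

theorem isUnit_det_fromBlocks_V2_zero :
    IsUnit (Matrix.fromBlocks (V2 0) 0 0 (V2 0)).det := by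
  have h : (Matrix.fromBlocks (V2 0) 0 0 (V2 0)).det = ((9 : ℤ) : PadicInt 2) := by
    rw [Matrix.det_fromBlocks_zero₂₁]
    simp only [V2, Matrix.det_fin_two_of]
    norm_num
  by_contra hn
  rw [h, PadicInt.not_isUnit_iff, PadicInt.norm_int_lt_one_iff_dvd] at hn
  revert hn
  decide

theorem U2_eq_smul (k : ℕ) : U2 k = (2 : PadicInt 2) ^ k • U2 0 := by
  simp [U2]

theorem V2_eq_smul (k : ℕ) : V2 k = (2 : PadicInt 2) ^ k • V2 0 := by
  simp [V2, pow_succ]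

/-- The case `k = 0`: the last two columns span the orthogonal complement of the first two, on
which the form is the negative of `V2 0`, and a root of `X ^ 2 + X + 2` removes the sign. -/
theorem exists_transpose_mul_fromBlocks_U2_zero_mul :
    ∃ P : Matrix (Fin 2 ⊕ Fin 2) (Fin 2 ⊕ Fin 2) (PadicInt 2),
      P.transpose * Matrix.fromBlocks (U2 0) 0 0 (U2 0) * P =
        Matrix.fromBlocks (V2 0) 0 0 (V2 0) := by
  obtain ⟨c, hc⟩ := exists_sq_add_self_add_two_eq_zero
  refine ⟨Matrix.fromBlocks !![1, 1; 1, 0] !![c + 1, c; -(c + 1), -c]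
    !![0, 1; 0, 1] !![c, -1; 1, c + 1], ?_⟩
  rw [Matrix.fromBlocks_transpose, Matrix.fromBlocks_multiply, Matrix.fromBlocks_multiply]
  congr 1 <;> ext i j <;> fin_cases i <;> fin_cases j <;>
    simp [U2, V2, Matrix.mul_apply, Fin.sum_univ_two] <;> grind

/-- Relation (b): `2U^{(2)}(2^k) ≅ 2V^{(2)}(2^k)` over `ℤ_2`. -/
theorem relation_b (k : ℕ) :
    ∃ P : Matrix (Fin 2 ⊕ Fin 2) (Fin 2 ⊕ Fin 2) (PadicInt 2), IsUnit P.det ∧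
      P.transpose * Matrix.fromBlocks (U2 k) 0 0 (U2 k) * P =
        Matrix.fromBlocks (V2 k) 0 0 (V2 k) := by
  obtain ⟨P, hP⟩ := exists_transpose_mul_fromBlocks_U2_zero_mul
  refine ⟨P, ?_, ?_⟩
  · have h := isUnit_det_fromBlocks_V2_zero
    rw [← hP, Matrix.det_mul] at h
    exact isUnit_of_mul_isUnit_right h
  · have scale (A : Matrix (Fin 2) (Fin 2) (PadicInt 2)) :
        Matrix.fromBlocks ((2 : PadicInt 2) ^ k • A) 0 0 ((2 : PadicInt 2) ^ k • A) =
          (2 : PadicInt 2) ^ k • Matrix.fromBlocks A 0 0 A := by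
      simp [Matrix.fromBlocks_smul]
    rw [U2_eq_smul, V2_eq_smul, scale, scale, Matrix.mul_smul, Matrix.smul_mul, hP]
end

section
/- Let k ≥ 0 be a natural number and let θ and θ' be units of the ring ℤ_2 of 2-adic integers. Then the 2×2 diagonal matrices diag(θ·2^k, θ'·2^k) and diag(5θ·2^k, 5θ'·2^k) are congruent over ℤ_2. -/
theorem PadicInt.two_norm_one_sub_unit_lt_one (u : (PadicInt 2)ˣ) :
    ‖1 - (u : PadicInt 2)‖ < 1 := by
  rw [← PadicInt.mem_nonunits, ← IsLocalRing.mem_maximalIdeal, ← PadicInt.ker_toZMod,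
    RingHom.mem_ker, map_sub, map_one]
  have hu : PadicInt.toZMod (u : PadicInt 2) ≠ 0 := (u.isUnit.map PadicInt.toZMod).ne_zero
  generalize PadicInt.toZMod (u : PadicInt 2) = a at hu
  revert a
  decide

/-- If `c` lies in the maximal ideal of `ℤ_p`, then `w ^ 2 + w = c` is solvable. -/
theorem PadicInt.exists_sq_add_self_eq {p : ℕ} [Fact p.Prime] {c : PadicInt p} (hc : ‖c‖ < 1) :
    ∃ w : PadicInt p, w ^ 2 + w = c := by
  obtain ⟨w, hw, -⟩ := hensels_lemma (p := p) (R := PadicInt p)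
    (F := Polynomial.X ^ 2 + Polynomial.X - Polynomial.C c) (a := 0) (by simpa using hc)
  refine ⟨w, ?_⟩
  simpa [sub_eq_zero] using hw

theorem PadicInt.two_exists_sq_add_unit_mul_four_eq_five (u : (PadicInt 2)ˣ) :
    ∃ x : PadicInt 2, x ^ 2 + 4 * (u : PadicInt 2) = 5 := by
  obtain ⟨w, hw⟩ := PadicInt.exists_sq_add_self_eq (PadicInt.two_norm_one_sub_unit_lt_one u)
  exact ⟨1 + 2 * w, by linear_combination 4 * hw⟩

theorem PadicInt.two_isUnit_five : IsUnit (5 : PadicInt 2) := by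
  have h : IsUnit ((5 : ℕ) : PadicInt 2) := by
    rw [PadicInt.isUnit_iff, PadicInt.norm_natCast_eq_one_iff]
    decide
  exact_mod_cast h


/-- Relation (c): `K_θ^{(2)}(2^k) ⊕ K_{θ'}^{(2)}(2^k) ≅ K_{5θ}^{(2)}(2^k) ⊕ K_{5θ'}^{(2)}(2^k)`. -/
theorem relation_c (k : ℕ) (θ θ' : (PadicInt 2)ˣ) :
    ∃ P : Matrix (Fin 2) (Fin 2) (PadicInt 2), IsUnit P.det ∧
      P.transpose *
          Matrix.diagonal ![(θ : PadicInt 2) * 2 ^ k, (θ' : PadicInt 2) * 2 ^ k] * P =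
        Matrix.diagonal ![5 * (θ : PadicInt 2) * 2 ^ k, 5 * (θ' : PadicInt 2) * 2 ^ k] := by
  obtain ⟨x, hx⟩ := PadicInt.two_exists_sq_add_unit_mul_four_eq_five (θ' * θ⁻¹)
  have hθ : (θ : PadicInt 2) * ((θ⁻¹ : (PadicInt 2)ˣ) : PadicInt 2) = 1 := θ.mul_inv
  rw [Units.val_mul] at hx
  generalize ((θ⁻¹ : (PadicInt 2)ˣ) : PadicInt 2) = t at hx hθ
  refine ⟨!![x, -(2 * θ' * t); 2, x], ?_, ?_⟩
  · have hdet : !![x, -(2 * θ' * t); 2, x].det = 5 := by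
      rw [Matrix.det_fin_two_of]
      linear_combination hx
    rw [hdet]
    exact PadicInt.two_isUnit_five
  · ext i j : 2
    fin_cases i <;> fin_cases j <;>
      simp [Matrix.mul_apply, Fin.sum_univ_two]
    · linear_combination (θ * 2 ^ k : PadicInt 2) * hx - (4 * θ' * 2 ^ k : PadicInt 2) * hθ
    · linear_combination -(2 * x * θ' * 2 ^ k : PadicInt 2) * hθ
    · linear_combination -(2 * x * θ' * 2 ^ k : PadicInt 2) * hθ
    · linear_combination (θ' * 2 ^ k : PadicInt 2) * hx + (4 * θ' ^ 2 * t * 2 ^ k : PadicInt 2) * hθ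
end

section
/- Let k ≥ 0 be a natural number and let θ and θ' be units of the ring ℤ_2 of 2-adic integers with θ' ≡ θ (mod 4), i.e., θ' − θ ∈ 4ℤ_2. Then the 3×3 diagonal matrix diag(θ·2^k, θ·2^k, θ'·2^k) is congruent over ℤ_2 to the block-diagonal matrix V(2^k) ⊕ [−5θ'·2^k]. -/
namespace PadicInt

theorem two_dvd_or_two_dvd_sub_one (x : ℤ_[2]) : 2 ∣ x ∨ 2 ∣ x - 1 := by
  have key (y : ℤ_[2]) (hy : toZMod y = 0) : 2 ∣ y := by
    rw [← RingHom.mem_ker, ker_toZMod, maximalIdeal_eq_span_p, Ideal.mem_span_singleton] at hy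
    simpa using hy
  have h2 : ∀ a : ZMod 2, a = 0 ∨ a - 1 = 0 := by decide
  rcases h2 (toZMod x) with h | h
  · exact .inl (key x h)
  · exact .inr (key _ (by simpa using h))

theorem isUnit_one_add_two_mul (x : ℤ_[2]) : IsUnit (1 + 2 * x) := by
  have h : (2 : ℤ_[2]) * x ∈ IsLocalRing.maximalIdeal ℤ_[2] := by
    rw [maximalIdeal_eq_span_p, Ideal.mem_span_singleton]
    exact_mod_cast dvd_mul_right _ _
  have h' := (IsLocalRing.mem_maximalIdeal _).1 h
  by_contra hn
  have := IsLocalRing.nonunits_add hn (mem_nonunits_iff.2 fun hu => h' ((IsUnit.neg_iff _).1 hu))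
  simp at this

theorem exists_eq_one_add_two_mul_of_isUnit {x : ℤ_[2]} (hx : IsUnit x) :
    ∃ s, x = 1 + 2 * s := by
  rcases two_dvd_or_two_dvd_sub_one x with h | ⟨s, h⟩
  · have h2 : IsUnit (2 : ℤ_[2]) := isUnit_of_dvd_unit h hx
    have := (prime_p (p := 2)).not_isUnit
    exact absurd h2 (by exact_mod_cast this)
  · exact ⟨s, by linear_combination h⟩

theorem exists_sq_sub_self_eq_two_mul (d : ℤ_[2]) : ∃ x : ℤ_[2], x ^ 2 - x = 2 * d := by
  let F : Polynomial ℤ_[2] := .X ^ 2 - .X - .C (2 * d)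
  have hF : F.aeval (0 : ℤ_[2]) = -(2 * d) := by simp [F]
  have hF' : F.derivative.aeval (0 : ℤ_[2]) = -1 := by simp [F]
  obtain ⟨x, hx, -⟩ := hensels_lemma (F := F) (a := 0) (by
    rw [hF, hF', norm_neg, norm_neg, norm_one, one_pow, norm_lt_one_iff_dvd]
    exact_mod_cast dvd_mul_right _ _)
  refine ⟨x, ?_⟩
  simp [F] at hx
  linear_combination hx

theorem exists_mul_sq_sub_self_eq_two_mul {a : ℤ_[2]} (ha : IsUnit a) (d : ℤ_[2]) :
    ∃ x : ℤ_[2], a * (x ^ 2 - x) = 2 * d := by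
  obtain ⟨b, hb⟩ := ha.exists_right_inv
  obtain ⟨x, hx⟩ := exists_sq_sub_self_eq_two_mul (b * d)
  exact ⟨x, by linear_combination a * hx + 2 * d * hb⟩

theorem exists_isUnit_sq_mul_eq {m : ℤ_[2]} (hm : IsUnit m) (d : ℤ_[2]) :
    ∃ l : ℤ_[2], IsUnit l ∧ l ^ 2 * m = m + 8 * d := by
  obtain ⟨x, hx⟩ := exists_mul_sq_sub_self_eq_two_mul hm d
  refine ⟨1 + 2 * (-x), isUnit_one_add_two_mul _, by linear_combination 4 * hx⟩

theorem exists_sq_eq_one_add_eight_mul_of_isUnit {x : ℤ_[2]} (hx : IsUnit x) :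
    ∃ s, x ^ 2 = 1 + 8 * s := by
  obtain ⟨s, rfl⟩ := exists_eq_one_add_two_mul_of_isUnit hx
  rcases two_dvd_or_two_dvd_sub_one s with ⟨t, rfl⟩ | ⟨t, h⟩
  · exact ⟨t + 2 * t ^ 2, by ring⟩
  · obtain rfl : s = 1 + 2 * t := by linear_combination h
    exact ⟨1 + 3 * t + 2 * t ^ 2, by ring⟩

end PadicInt

/-- Relation (d), first case: if `θ' ≡ θ (mod 4)` then
`2K_θ^{(2)}(2^k) ⊕ K_{θ'}^{(2)}(2^k) ≅ V^{(2)}(2^k) ⊕ K_{-5θ'}^{(2)}(2^k)`. -/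
theorem relation_d_first (k : ℕ) (θ θ' : (PadicInt 2)ˣ)
    (hcong : ∃ c : PadicInt 2, (θ' : PadicInt 2) - (θ : PadicInt 2) = 4 * c) :
    ∃ P : Matrix (Fin 3) (Fin 3) (PadicInt 2), IsUnit P.det ∧
      P.transpose *
          Matrix.diagonal ![(θ : PadicInt 2) * 2 ^ k, (θ : PadicInt 2) * 2 ^ k,
            (θ' : PadicInt 2) * 2 ^ k] * P =
        !![2 ^ (k + 1), 2 ^ k, 0;
           2 ^ k, 2 ^ (k + 1), 0;
           0, 0, -5 * (θ' : PadicInt 2) * 2 ^ k] := by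
  obtain ⟨c, hc⟩ := hcong
  have hθ := θ.isUnit
  generalize (θ : PadicInt 2) = t at hθ hc ⊢
  obtain ⟨t', ht'⟩ : ∃ t' : PadicInt 2, t' = θ' := ⟨_, rfl⟩
  rw [← ht'] at hc ⊢
  obtain rfl : t' = t + 4 * c := by linear_combination hc
  clear ht' hc
  obtain ⟨s, hs⟩ := PadicInt.exists_eq_one_add_two_mul_of_isUnit hθ
  obtain ⟨r, hr⟩ := PadicInt.exists_sq_eq_one_add_eight_mul_of_isUnit hθ
  obtain ⟨x, hx⟩ := PadicInt.exists_mul_sq_sub_self_eq_two_mul hθ (-s - c)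
  have hu : IsUnit (t * (2 * x - 1)) := by
    rw [show t * (2 * x - 1) = -(t * (1 + 2 * (-x))) by ring]
    exact (hθ.mul (PadicInt.isUnit_one_add_two_mul _)).neg
  obtain ⟨v, hv⟩ := hu.exists_right_inv
  have hvu : IsUnit v := .of_mul_eq_one_right _ hv
  obtain ⟨y, hy⟩ := PadicInt.exists_eq_one_add_two_mul_of_isUnit (hθ.mul (hvu.pow 2))
  have ha : IsUnit (4 * (t * v ^ 2) - 1) := by
    rw [show 4 * (t * v ^ 2) - 1 = -(1 + 2 * (-2 * (t * v ^ 2))) by ring]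
    exact (PadicInt.isUnit_one_add_two_mul _).neg
  obtain ⟨q, hq⟩ := PadicInt.exists_mul_sq_sub_self_eq_two_mul ha (-y)
  have hb : IsUnit (3 * t + 8 * c) := by
    rw [show 3 * t + 8 * c = 1 + 2 * (1 + 3 * s + 4 * c) by rw [hs]; ring]
    exact PadicInt.isUnit_one_add_two_mul _
  obtain ⟨l, hlu, hl⟩ := PadicInt.exists_isUnit_sq_mul_eq
    (hθ.mul hb) (-1 - 3 * r - t * c)
  refine ⟨!![x, (1 - 2 * q) * v + q * x, l * (t + 4 * c);
             1 - x, q - ((1 - 2 * q) * v + q * x), l * (t + 4 * c);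
             -1, -q, l * t], ?_, ?_⟩
  · have hdet : IsUnit ((1 + 2 * (-q)) * v * (l * (3 * t + 8 * c))) :=
      ((PadicInt.isUnit_one_add_two_mul _).mul hvu).mul (hlu.mul hb)
    convert hdet.neg using 1
    rw [Matrix.det_fin_three]
    simp
    ring
  · ext i j
    fin_cases i <;> fin_cases j <;>
      simp [Matrix.mul_apply, Fin.sum_univ_three, Matrix.diagonal_apply]
    · linear_combination 2 * 2 ^ k * hx + 2 * 2 ^ k * hs
    · linear_combination 2 ^ k * ((1 - 2 * q) * hv + 2 * q * (hx + hs))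
    · ring
    · linear_combination 2 ^ k * ((1 - 2 * q) * hv + 2 * q * (hx + hs))
    · linear_combination 2 ^ k * (2 * hq + 2 * hy + 2 * q * (1 - 2 * q) * hv
        + 2 * q ^ 2 * (hx + hs))
    · ring
    · ring
    · ring
    · linear_combination 2 ^ k * (t + 4 * c) * (hl + 3 * hr)
end

section
/- Let k ≥ 0 be a natural number and let θ and θ' be units of the ring ℤ_2 of 2-adic integers with θ' ≡ −θ (mod 4), i.e., θ' + θ ∈ 4ℤ_2. Then the 3×3 diagonal matrix diag(θ·2^k, θ·2^k, θ'·2^k) is congruent over ℤ_2 to the block-diagonal matrix U(2^k) ⊕ [−θ'·2^k]. -/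
/-- A ternary diagonal form `⟨a, a, b⟩` with `4 ∣ a + b` that represents zero at `(x, y, 1)` is
congruent to the orthogonal sum of a hyperbolic plane and `⟨-b⟩` if `a * y + b` is a unit. -/
theorem exists_congruence_diagonal_hyperbolic {R : Type*} [CommRing R] {a b c t x y : R} (m : R)
    (hc : b + a = 4 * c) (hxy : a * (x ^ 2 + y ^ 2) + b = 0) (ht : (a * y + b) * t = 1) :
    ∃ P : Matrix (Fin 3) (Fin 3) R, a * P.det = -1 ∧
      P.transpose * Matrix.diagonal ![a * m, a * m, b * m] * P =
        !![0, m, 0; m, 0, 0; 0, 0, -b * m] := by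
  refine ⟨!![x, -2 * c * t ^ 2 * x, (y - 1) * b * t;
             y, t - 2 * c * t ^ 2 * y, -x * b * t;
             1, t - 2 * c * t ^ 2, x * a * t], ?_, ?_⟩
  · simp only [Matrix.det_fin_three, Matrix.of_apply, Matrix.cons_val]
    linear_combination t ^ 2 * (a + b) * hxy - ((a * y + b) * t + 1) * ht
  · ext i j
    fin_cases i <;> fin_cases j <;>
      simp [Matrix.mul_apply, Fin.sum_univ_three, Matrix.diagonal_apply]
    · linear_combination m * hxy
    · linear_combination m * ht - 2 * c * t ^ 2 * m * hxy
    · ring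
    · linear_combination m * ht - 2 * c * t ^ 2 * m * hxy
    · linear_combination m * t ^ 2 * hc - 4 * c * t ^ 2 * m * ht + 4 * c ^ 2 * t ^ 4 * m * hxy
    · ring
    · ring
    · ring
    · linear_combination m * t ^ 2 * (b ^ 2 + a * b) * hxy - m * b * ((a * y + b) * t + 1) * ht

theorem PadicInt.two_mem_maximalIdeal : (2 : ℤ_[2]) ∈ IsLocalRing.maximalIdeal ℤ_[2] := by
  rw [PadicInt.maximalIdeal_eq_span_p]
  exact Ideal.mem_span_singleton_self _

/-- The polynomial `X ^ 2 + X + d ^ 2 - d` has a root in `ℤ_[2]`. -/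
theorem PadicInt.exists_sq_add_self_add_sq_eq (d : ℤ_[2]) : ∃ z : ℤ_[2], z ^ 2 + z + d ^ 2 = d := by
  have hd : d ^ 2 - d ∈ IsLocalRing.maximalIdeal ℤ_[2] := by
    rw [← PadicInt.ker_toZMod, RingHom.mem_ker, map_sub, map_pow]
    generalize PadicInt.toZMod d = r
    revert r
    decide
  let f : Polynomial ℤ_[2] := .X ^ 2 + .X + .C (d ^ 2 - d)
  have hf : f.Monic := by
    unfold f
    monicity!
  obtain ⟨z, hz, -⟩ := HenselianRing.is_henselian (I := IsLocalRing.maximalIdeal ℤ_[2])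
    f hf 0 (by simpa [f] using hd)
    (by simp [f, -map_sub, -map_pow])
  refine ⟨z, ?_⟩
  simp only [f, Polynomial.IsRoot.def, Polynomial.eval_add, Polynomial.eval_pow, Polynomial.eval_X,
    Polynomial.eval_C] at hz
  linear_combination hz

/-- Relation (d), second case: if `θ' ≡ -θ (mod 4)` then
`2K_θ^{(2)}(2^k) ⊕ K_{θ'}^{(2)}(2^k) ≅ U^{(2)}(2^k) ⊕ K_{-θ'}^{(2)}(2^k)`. -/
theorem relation_d_second (k : ℕ) (θ θ' : (PadicInt 2)ˣ)
    (hcong : ∃ c : PadicInt 2, (θ' : PadicInt 2) + (θ : PadicInt 2) = 4 * c) :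
    ∃ P : Matrix (Fin 3) (Fin 3) (PadicInt 2), IsUnit P.det ∧
      P.transpose *
          Matrix.diagonal ![(θ : PadicInt 2) * 2 ^ k, (θ : PadicInt 2) * 2 ^ k,
            (θ' : PadicInt 2) * 2 ^ k] * P =
        !![0, 2 ^ k, 0;
           2 ^ k, 0, 0;
           0, 0, -(θ' : PadicInt 2) * 2 ^ k] := by
  obtain ⟨c, hc⟩ := hcong
  obtain ⟨d, hd⟩ : ∃ d : ℤ_[2], (θ : ℤ_[2]) * d = -c :=
    ⟨(θ⁻¹ : ℤ_[2]ˣ) * -c, Units.mul_inv_cancel_left _ _⟩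
  obtain ⟨z, hz⟩ := PadicInt.exists_sq_add_self_add_sq_eq d
  have hs : IsUnit ((θ : ℤ_[2]) * (2 * d) + θ') := by
    by_contra h
    refine (IsLocalRing.mem_maximalIdeal _).1 ?_ θ'.isUnit
    have h2 := Ideal.mul_mem_left _ ((θ : ℤ_[2]) * d) PadicInt.two_mem_maximalIdeal
    convert Ideal.sub_mem _ ((IsLocalRing.mem_maximalIdeal _).2 h) h2 using 1
    ring
  obtain ⟨t, ht⟩ := hs.exists_right_inv
  obtain ⟨P, hdet, hP⟩ := exists_congruence_diagonal_hyperbolic (2 ^ k) hc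
    (x := 1 + 2 * z) (by linear_combination 4 * (θ : ℤ_[2]) * hz + 4 * hd + hc) ht
  exact ⟨P, .of_mul_eq_one (-(θ : ℤ_[2])) (by linear_combination -hdet), hP⟩
end

section
/- Let k ≥ 0 be a natural number and let θ be a unit of the ring ℤ_2 of 2-adic integers. Then the 3×3 block-diagonal matrix V(2^k) ⊕ [θ·2^(k+1)] is congruent over ℤ_2 to the 3×3 block-diagonal matrix U(2^k) ⊕ [5θ·2^(k+1)]. -/
namespace PadicInt

theorem isUnit_two_mul_add_one (x : PadicInt 2) : IsUnit (2 * x + 1) := by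
  by_contra h
  rw [not_isUnit_iff, norm_lt_one_iff_dvd] at h
  obtain ⟨y, hy⟩ := h
  have h2 : (2 : PadicInt 2) ∣ 1 := ⟨y - x, by push_cast at hy; linear_combination hy⟩
  exact prime_p.not_isUnit (by exact_mod_cast isUnit_of_dvd_one h2)

theorem two_dvd_unit_add_one (θ : (PadicInt 2)ˣ) : (2 : PadicInt 2) ∣ θ + 1 := by
  obtain ⟨n, hn, h⟩ := exists_mem_range (p := 2) (θ : PadicInt 2)
  rw [maximalIdeal_eq_span_p, Ideal.mem_span_singleton] at h
  push_cast at h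
  interval_cases n
  · have : (2 : PadicInt 2) ∣ θ := by simpa using h
    exact absurd (isUnit_of_dvd_unit this θ.isUnit) (by exact_mod_cast prime_p.not_isUnit)
  · obtain ⟨y, hy⟩ := h
    exact ⟨y + 1, by push_cast at hy; linear_combination hy⟩

theorem exists_sq_add_self_add_eq_zero {c : PadicInt 2} (hc : 2 ∣ c) :
    ∃ x : PadicInt 2, x ^ 2 + x + c = 0 := by
  have hnorm : ‖c‖ < 1 := (norm_lt_one_iff_dvd c).2 (by exact_mod_cast hc)
  obtain ⟨x, hx, -⟩ := hensels_lemma (p := 2) (R := PadicInt 2)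
    (F := Polynomial.X ^ 2 + Polynomial.X + Polynomial.C c) (a := 0)
    (by simpa [Polynomial.derivative_add] using hnorm)
  exact ⟨x, by simpa using hx⟩

end PadicInt

/-- Relation (e): `V^{(2)}(2^k) ⊕ K_θ^{(2)}(2^{k+1}) ≅ U^{(2)}(2^k) ⊕ K_{5θ}^{(2)}(2^{k+1})`. -/
theorem relation_e (k : ℕ) (θ : (PadicInt 2)ˣ) :
    ∃ P : Matrix (Fin 3) (Fin 3) (PadicInt 2), IsUnit P.det ∧
      P.transpose *
          !![2 ^ (k + 1), 2 ^ k, 0;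
             2 ^ k, 2 ^ (k + 1), 0;
             0, 0, (θ : PadicInt 2) * 2 ^ (k + 1)] * P =
        !![0, 2 ^ k, 0;
           2 ^ k, 0, 0;
           0, 0, 5 * (θ : PadicInt 2) * 2 ^ (k + 1)] := by
  -- The isotropic vector `(a, 1, 1)` is completed to a hyperbolic pair; the orthogonal
  -- complement of that pair is then rescaled using a square root `2 * r + 1` of `-15`.
  obtain ⟨a, ha⟩ := PadicInt.exists_sq_add_self_add_eq_zero (PadicInt.two_dvd_unit_add_one θ)
  obtain ⟨r, hr⟩ := PadicInt.exists_sq_add_self_add_eq_zero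
    (show (2 : PadicInt 2) ∣ 4 from ⟨2, by norm_num⟩)
  obtain ⟨j, hj⟩ := (PadicInt.isUnit_two_mul_add_one a).exists_right_inv
  obtain ⟨t, ht⟩ := (PadicInt.isUnit_two_mul_add_one 1).exists_right_inv
  have hθ : (θ : PadicInt 2) = -(a ^ 2 + a + 1) := by linear_combination ha
  rw [hθ]
  generalize hK : (2 : PadicInt 2) ^ k = K
  refine ⟨!![a, j - j ^ 2 * a, (2 * r + 1) * t * j * (-2 * (a ^ 2 + a + 1));
    1, -j ^ 2, (2 * r + 1) * t * j * (4 * (a ^ 2 + a + 1));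
    1, -j ^ 2, (2 * r + 1) * t * j * 3], ?_, ?_⟩
  · have hdet : Matrix.det !![a, j - j ^ 2 * a, (2 * r + 1) * t * j * (-2 * (a ^ 2 + a + 1));
        1, -j ^ 2, (2 * r + 1) * t * j * (4 * (a ^ 2 + a + 1));
        1, -j ^ 2, (2 * r + 1) * t * j * 3] = (2 * r + 1) * t := by
      rw [Matrix.det_fin_three]
      simp
      grind
    rw [hdet]
    exact (PadicInt.isUnit_two_mul_add_one r).mul (IsUnit.of_mul_eq_one_right _ ht)
  · ext i l
    fin_cases i <;> fin_cases l <;>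
      simp [Matrix.mul_apply, Fin.sum_univ_three, pow_succ, hK] <;> grind
end

section
/- Let k ≥ 0 be a natural number and let θ be a unit of the ring ℤ_2 of 2-adic integers. Then the 3×3 block-diagonal matrix [θ·2^k] ⊕ V(2^(k+1)) is congruent over ℤ_2 to the 3×3 block-diagonal matrix [5θ·2^k] ⊕ U(2^(k+1)). -/
open Polynomial in
/-- A quadratic `a X² + b X + c` over `ℤ_[p]` with unit linear coefficient and `c` divisible by `p`
has a root. -/
theorem PadicInt.exists_quadratic_root {p : ℕ} [Fact p.Prime] (a b c : PadicInt p) (hb : IsUnit b)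
    (hc : ‖c‖ < 1) : ∃ t : PadicInt p, a * t ^ 2 + b * t + c = 0 := by
  have h := hensels_lemma (p := p) (F := C a * X ^ 2 + C b * X + C c) (a := (0 : PadicInt p))
    (by simpa [PadicInt.isUnit_iff.mp hb] using hc)
  obtain ⟨t, ht, -⟩ := h
  exact ⟨t, by simpa using ht⟩

theorem PadicInt.norm_one_sub_unit_lt_one (θ : (PadicInt 2)ˣ) : ‖1 - (θ : PadicInt 2)‖ < 1 := by
  rw [← PadicInt.mem_nonunits, ← IsLocalRing.mem_maximalIdeal, ← PadicInt.ker_toZMod,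
    RingHom.mem_ker, map_sub, map_one]
  have h : PadicInt.toZMod (θ : PadicInt 2) ≠ 0 := (θ.isUnit.map PadicInt.toZMod).ne_zero
  generalize PadicInt.toZMod (θ : PadicInt 2) = z at h
  revert h
  decide +revert

theorem PadicInt.isUnit_one_add_two_mul_s6 (r : PadicInt 2) : IsUnit (1 + 2 * r) := by
  rw [← not_not (a := IsUnit _), ← mem_nonunits_iff, ← IsLocalRing.mem_maximalIdeal,
    ← PadicInt.ker_toZMod, RingHom.mem_ker, map_add, map_mul, map_ofNat, map_one]
  generalize PadicInt.toZMod r = z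
  decide +revert

/-- Relation (f): `K_θ^{(2)}(2^k) ⊕ V^{(2)}(2^{k+1}) ≅ K_{5θ}^{(2)}(2^k) ⊕ U^{(2)}(2^{k+1})`. -/
theorem relation_f (k : ℕ) (θ : (PadicInt 2)ˣ) :
    ∃ P : Matrix (Fin 3) (Fin 3) (PadicInt 2), IsUnit P.det ∧
      P.transpose *
          !![(θ : PadicInt 2) * 2 ^ k, 0, 0;
             0, 2 ^ (k + 2), 2 ^ (k + 1);
             0, 2 ^ (k + 1), 2 ^ (k + 2)] * P =
        !![5 * (θ : PadicInt 2) * 2 ^ k, 0, 0;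
           0, 0, 2 ^ (k + 1);
           0, 2 ^ (k + 1), 0] := by
  have h5 : IsUnit (5 : PadicInt 2) := by
    convert PadicInt.isUnit_one_add_two_mul_s6 2 using 1; norm_num
  obtain ⟨y, hy⟩ := PadicInt.exists_quadratic_root 1 1 (1 - (θ : PadicInt 2)) isUnit_one
    (PadicInt.norm_one_sub_unit_lt_one θ)
  obtain ⟨s, hs⟩ := PadicInt.exists_quadratic_root (p := 2) 2 9 12
    (by convert PadicInt.isUnit_one_add_two_mul_s6 4 using 1; norm_num)
    (by
      rw [← PadicInt.mem_nonunits, ← IsLocalRing.mem_maximalIdeal, ← PadicInt.ker_toZMod,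
        RingHom.mem_ker, map_ofNat]
      decide)
  obtain ⟨r, hr⟩ : ∃ r : PadicInt 2, 2 * r ^ 2 + 5 * r + 5 = 0 :=
    ⟨s + 1, by linear_combination hs⟩
  obtain ⟨c, hc⟩ : ∃ c : PadicInt 2, (5 + 4 * r) * c = 1 :=
    (show IsUnit (5 + 4 * r) by
      convert PadicInt.isUnit_one_add_two_mul_s6 (2 + 2 * r) using 1; ring).exists_right_inv
  obtain ⟨τ, hτ⟩ : ∃ τ : PadicInt 2, (θ : PadicInt 2) * τ = 1 := θ.isUnit.exists_right_inv
  generalize (θ : PadicInt 2) = θ at *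
  -- In `ℤ_2[ω]` with `ω² = ω - 1`, the last two columns of `A` are `1` and `ω` times `y + ω`,
  -- corrected to be orthogonal to the first.
  let A : Matrix (Fin 3) (Fin 3) (PadicInt 2) := !![1, -4, -2; y, y, -1; 1, 1, y + 1]
  let B : Matrix (Fin 3) (Fin 3) (PadicInt 2) :=
    !![1, 0, 0; 0, -2 * c * τ, c; 0, (5 + 2 * r) * c * τ, r * c]
  have hA : A.transpose * !![θ * 2 ^ k, 0, 0; 0, 2 ^ (k + 2), 2 ^ (k + 1);
      0, 2 ^ (k + 1), 2 ^ (k + 2)] * A =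
      !![5 * θ * 2 ^ k, 0, 0; 0, 20 * θ * 2 ^ k, 10 * θ * 2 ^ k;
        0, 10 * θ * 2 ^ k, 8 * θ * 2 ^ k] := by
    obtain rfl : θ = y ^ 2 + y + 1 := by linear_combination -hy
    ext i j
    fin_cases i <;> fin_cases j <;> simp [A, Matrix.mul_apply, Fin.sum_univ_three] <;> ring
  have hB : B.transpose * !![5 * θ * 2 ^ k, 0, 0; 0, 20 * θ * 2 ^ k, 10 * θ * 2 ^ k;
        0, 10 * θ * 2 ^ k, 8 * θ * 2 ^ k] * B =
      !![5 * θ * 2 ^ k, 0, 0; 0, 0, 2 ^ (k + 1); 0, 2 ^ (k + 1), 0] := by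
    have h₁₁ : 20 * 4 - 2 * 20 * (5 + 2 * r) + 8 * (5 + 2 * r) ^ 2 = 0 := by
      linear_combination 16 * hr
    have h₁₂ : 2 ^ k * θ * τ * c ^ 2 * (-40 + 10 * (5 + 2 * r) - 20 * r + 8 * r * (5 + 2 * r)) =
        2 ^ (k + 1) := by
      linear_combination 2 ^ k * θ * τ * c ^ 2 * (-8) * hr +
        2 * 2 ^ k * (((5 + 4 * r) * c) ^ 2 * hτ + ((5 + 4 * r) * c + 1) * hc)
    ext i j
    fin_cases i <;> fin_cases j <;> simp [B, Matrix.mul_apply, Fin.sum_univ_three]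
    · linear_combination 2 ^ k * θ * τ ^ 2 * c ^ 2 * h₁₁
    · linear_combination h₁₂
    · linear_combination h₁₂
    · linear_combination 2 ^ k * θ * c ^ 2 * 4 * hr
  refine ⟨A * B, ?_, ?_⟩
  · have hdet : (A * B).det = -(5 * c) := by
      rw [Matrix.det_mul]
      simp only [A, B, Matrix.det_fin_three, Matrix.of_apply, Matrix.cons_val]
      linear_combination -5 * c ^ 2 * τ * (5 + 4 * r) * hy - 5 * c * ((5 + 4 * r) * c * hτ + hc)
    rw [hdet]
    exact (h5.mul (.of_mul_eq_one_right _ hc)).neg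
  · rw [← hB, ← hA]
    simp only [Matrix.transpose_mul, Matrix.mul_assoc]
end

section
/- Let k ≥ 0 be a natural number and let θ and θ' be units of the ring ℤ_2 of 2-adic integers. Then the 2×2 diagonal matrix diag(θ·2^k, θ'·2^(k+1)) is congruent over ℤ_2 to the 2×2 diagonal matrix diag((θ+2θ')·2^k, 5(θ'−2θ)·2^(k+1)). -/
theorem PadicInt.two_dvd_or_two_dvd_sub_one_s7 (x : PadicInt 2) : 2 ∣ x ∨ 2 ∣ x - 1 := by
  obtain ⟨n, hn, hx⟩ := PadicInt.exists_mem_range (p := 2) x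
  rw [PadicInt.maximalIdeal_eq_span_p, Ideal.mem_span_singleton] at hx
  interval_cases n
  · left; simpa using hx
  · right; simpa using hx

theorem PadicInt.isUnit_iff_not_two_dvd {x : PadicInt 2} : IsUnit x ↔ ¬ 2 ∣ x := by
  have h := PadicInt.norm_lt_one_iff_dvd (p := 2) x
  rw [PadicInt.isUnit_iff, ← Nat.cast_ofNat (R := PadicInt 2) (n := 2), ← h, not_lt]
  exact ⟨fun h => h.ge, fun h => le_antisymm x.norm_le_one h⟩

theorem PadicInt.exists_eq_one_add_two_mul {x : PadicInt 2} (hx : IsUnit x) :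
    ∃ s, x = 1 + 2 * s := by
  obtain ⟨s, hs⟩ := (PadicInt.two_dvd_or_two_dvd_sub_one_s7 x).resolve_left
    (PadicInt.isUnit_iff_not_two_dvd.1 hx)
  exact ⟨s, by linear_combination hs⟩

theorem PadicInt.exists_sq_eq_one_add_eight_mul {x : PadicInt 2} (hx : IsUnit x) :
    ∃ t, x ^ 2 = 1 + 8 * t := by
  obtain ⟨s, rfl⟩ := PadicInt.exists_eq_one_add_two_mul hx
  rcases PadicInt.two_dvd_or_two_dvd_sub_one_s7 s with ⟨q, hq⟩ | ⟨q, hq⟩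
  · exact ⟨q * (s + 1), by linear_combination 4 * (s + 1) * hq⟩
  · exact ⟨(q + 1) * s, by linear_combination 4 * s * hq⟩

theorem PadicInt.isUnit_add_two_mul {x : PadicInt 2} (hx : IsUnit x) (y : PadicInt 2) :
    IsUnit (x + 2 * y) := by
  rw [PadicInt.isUnit_iff_not_two_dvd] at hx ⊢
  rwa [dvd_add_left (dvd_mul_right 2 y)]

/-- Units of `ℤ_[2]` that agree modulo `8` differ by the square of a unit. -/
theorem PadicInt.exists_isUnit_sq_mul_eq_s7 {u w : PadicInt 2} (hu : IsUnit u)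
    (h : 8 ∣ u - w) : ∃ c, IsUnit c ∧ c ^ 2 * u = w := by
  have hnorm : ‖u - w‖ ≤ 1 / 8 := by
    have := (PadicInt.norm_le_pow_iff_mem_span_pow (p := 2) (u - w) 3).2
      (Ideal.mem_span_singleton.2 (by norm_num; exact h))
    norm_num at this ⊢
    exact this
  have htwo : ‖(2 : PadicInt 2)‖ = 1 / 2 := by
    simpa using PadicInt.norm_p (p := 2)
  have hw : IsUnit w := by
    obtain ⟨d, hd⟩ := h
    rw [show w = u + 2 * (-4 * d) by linear_combination -hd]
    exact PadicInt.isUnit_add_two_mul hu _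
  obtain ⟨c, hc, -⟩ := hensels_lemma
    (F := Polynomial.C u * Polynomial.X ^ 2 - Polynomial.C w) (a := (1 : PadicInt 2)) (by
      simp only [Polynomial.derivative_C_mul,
        Polynomial.derivative_X_pow, Polynomial.derivative_C, map_sub, map_mul, map_pow,
        Polynomial.aeval_X, Polynomial.aeval_C]
      simp only [Algebra.algebraMap_self, RingHom.id_apply, one_pow, mul_one, sub_zero,
        Nat.cast_ofNat, map_ofNat, map_zero, norm_mul, htwo, PadicInt.isUnit_iff.1 hu]
      linarith)
  have hcw : c ^ 2 * u = w := by
    simp at hc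
    linear_combination hc
  refine ⟨c, ?_, hcw⟩
  rw [← hcw] at hw
  exact (isUnit_pow_iff two_ne_zero).1 (isUnit_of_mul_isUnit_left hw)

/-- Relation (g):
`K_θ^{(2)}(2^k) ⊕ K_{θ'}^{(2)}(2^{k+1}) ≅ K_{θ+2θ'}^{(2)}(2^k) ⊕ K_{5(θ'-2θ)}^{(2)}(2^{k+1})`. -/
theorem relation_g (k : ℕ) (θ θ' : (PadicInt 2)ˣ) :
    ∃ P : Matrix (Fin 2) (Fin 2) (PadicInt 2), IsUnit P.det ∧
      P.transpose *
          Matrix.diagonal ![(θ : PadicInt 2) * 2 ^ k, (θ' : PadicInt 2) * 2 ^ (k + 1)] * P =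
        Matrix.diagonal ![((θ : PadicInt 2) + 2 * (θ' : PadicInt 2)) * 2 ^ k,
          5 * ((θ' : PadicInt 2) - 2 * (θ : PadicInt 2)) * 2 ^ (k + 1)] := by
  obtain ⟨a, ha⟩ : ∃ a : PadicInt 2, a = θ := ⟨_, rfl⟩
  obtain ⟨b, hb⟩ : ∃ b : PadicInt 2, b = θ' := ⟨_, rfl⟩
  have hua : IsUnit a := ha ▸ θ.isUnit
  have hub : IsUnit b := hb ▸ θ'.isUnit
  rw [← ha, ← hb]
  have hab : IsUnit (a + 2 * b) := PadicInt.isUnit_add_two_mul hua b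
  obtain ⟨s, hs⟩ := PadicInt.exists_eq_one_add_two_mul hua
  obtain ⟨q, hq⟩ := PadicInt.exists_eq_one_add_two_mul hub
  obtain ⟨t, ht⟩ := PadicInt.exists_sq_eq_one_add_eight_mul hua
  obtain ⟨r, hr⟩ := PadicInt.exists_sq_eq_one_add_eight_mul hub
  obtain ⟨c, hc, hcw⟩ := PadicInt.exists_isUnit_sq_mul_eq_s7
    (w := 5 * (b - 2 * a)) ((hua.mul hub).mul hab)
    ⟨1 - q + 3 * s + b * t + 2 * a * r, by
      linear_combination b * ht + 2 * a * hr - 4 * hq + 12 * hs⟩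
  refine ⟨!![1, -2 * b * c; 1, a * c], ?_, ?_⟩
  · rw [Matrix.det_fin_two_of, show 1 * (a * c) - -2 * b * c * 1 = (a + 2 * b) * c by ring]
    exact hab.mul hc
  · ext i j
    fin_cases i <;> fin_cases j <;>
      simp [Matrix.mul_apply, Fin.sum_univ_two, Matrix.diagonal_apply]
    · ring
    · ring
    · ring
    · linear_combination 2 ^ (k + 1) * hcw
end

section
/- Let p be an odd prime, let k ≥ 1 be a natural number, let c be an integer not divisible by p, and let η ∈ {0,1} be such that the Legendre symbol (2c/p) equals (−1)^η. Then the quadratic Gauss sum satisfies ∑_{m=0}^{p^k − 1} exp(2πi·c·m²/p^k) = p^{k/2} · exp(2πi·(k²(1−p) + 4kη)/8). (Equivalently, the signature mod 8 of the finite quadratic form q_θ^{(p)}(p^k) is k²(1−p) + 4kη mod 8, where (θ/p) = (−1)^η.) -/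
open Finset

open Complex Filter Topology in
/-- For real `x`, the theta function `jacobiTheta₂ x τ` tends to `1` as `im τ → ∞`. -/
lemma tendsto_jacobiTheta₂_one {α : Type*} {l : Filter α} (x : ℝ) {τ : α → ℂ}
    (hτ : Tendsto (fun a => (τ a).im) l atTop) :
    Tendsto (fun a => jacobiTheta₂ x (τ a)) l (𝓝 1) := by
  have hbound : Summable fun n : ℤ => ‖jacobiTheta₂_term n 0 I‖ :=
    ((summable_jacobiTheta₂_term_iff 0 I).2 (by simp)).norm
  have key := tendsto_tsum_of_dominated_convergence
    (f := fun a (n : ℤ) => jacobiTheta₂_term n x (τ a))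
    (g := fun n : ℤ => if n = 0 then (1 : ℂ) else 0) hbound (𝓕 := l) ?_ ?_
  · simpa [jacobiTheta₂, tsum_ite_eq] using key
  · intro n
    rcases eq_or_ne n 0 with rfl | hn
    · simp [jacobiTheta₂_term, tendsto_const_nhds]
    · simp only [hn, if_false]
      rw [tendsto_zero_iff_norm_tendsto_zero]
      simp only [norm_jacobiTheta₂_term, ofReal_im, mul_zero, sub_zero]
      refine Real.tendsto_exp_atBot.comp (hτ.const_mul_atTop_of_neg ?_)
      have : (0 : ℝ) < (n : ℝ) ^ 2 := by positivity
      nlinarith [Real.pi_pos]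
  · filter_upwards [hτ.eventually_ge_atTop 1] with a ha n
    simp only [norm_jacobiTheta₂_term, ofReal_im, mul_zero, sub_zero, zero_im, I_im, mul_one]
    refine Real.exp_le_exp.2 ?_
    have : (0 : ℝ) ≤ Real.pi * (n : ℝ) ^ 2 := by positivity
    nlinarith

open Complex in
/-- If `n ↦ exp (π i s n²)` is `M`-periodic, then the theta series at `s + t` splits over residue
classes modulo `M`, and each class can be transformed by the functional equation. -/
lemma jacobiTheta_add_of_periodic {M : ℕ} (hM : M ≠ 0) {s t : ℂ} (ht : 0 < t.im)
    (hst : 0 < (s + t).im)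
    (hs : ∀ n : ℤ, ∀ r : ℕ, cexp (Real.pi * I * (n * M + r : ℂ) ^ 2 * s)
      = cexp (Real.pi * I * (r : ℂ) ^ 2 * s)) :
    jacobiTheta (s + t) = 1 / (-I * (M ^ 2 * t)) ^ (1 / 2 : ℂ) *
      ∑ r ∈ range M, cexp (Real.pi * I * (r : ℂ) ^ 2 * s) *
        jacobiTheta₂ ((r / M : ℝ) : ℂ) (-1 / (M ^ 2 * t)) := by
  have : NeZero M := ⟨hM⟩
  have hMc : (M : ℂ) ≠ 0 := by exact_mod_cast hM
  have ht0 : t ≠ 0 := by rintro rfl; simp at ht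
  have hsum : Summable fun n : ℤ => cexp (Real.pi * I * (n : ℂ) ^ 2 * (s + t)) := by
    simpa [jacobiTheta₂_term] using (summable_jacobiTheta₂_term_iff 0 (s + t)).2 hst
  have hsum' := (Int.divModEquiv M).symm.summable_iff.2 hsum
  have hclass (r : ℕ) : ∑' n : ℤ, cexp (Real.pi * I * (n * M + r : ℂ) ^ 2 * (s + t))
      = cexp (Real.pi * I * (r : ℂ) ^ 2 * s) * (1 / (-I * (M ^ 2 * t)) ^ (1 / 2 : ℂ) *
        jacobiTheta₂ ((r / M : ℝ) : ℂ) (-1 / (M ^ 2 * t))) := by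
    have hfe := jacobiTheta₂_functional_equation (r * M * t) (M ^ 2 * t)
    have h1 : (r * M * t : ℂ) / (M ^ 2 * t) = ((r / M : ℝ) : ℂ) := by
      push_cast; field_simp
    have h2 : cexp (Real.pi * I * (r : ℂ) ^ 2 * t) *
        cexp (-Real.pi * I * (r * M * t : ℂ) ^ 2 / (M ^ 2 * t)) = 1 := by
      rw [← Complex.exp_add, Complex.exp_eq_one_iff]
      exact ⟨0, by field_simp; simp⟩
    have h3 : ∑' n : ℤ, cexp (Real.pi * I * (n * M + r : ℂ) ^ 2 * (s + t))
        = cexp (Real.pi * I * (r : ℂ) ^ 2 * s) * (cexp (Real.pi * I * (r : ℂ) ^ 2 * t) *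
          jacobiTheta₂ (r * M * t) (M ^ 2 * t)) := by
      rw [jacobiTheta₂, ← tsum_mul_left, ← tsum_mul_left]
      refine tsum_congr fun n => ?_
      rw [mul_add, Complex.exp_add, hs, jacobiTheta₂_term]
      simp only [← Complex.exp_add]
      congr 1
      ring
    rw [h3, hfe, h1]
    linear_combination (cexp (Real.pi * I * (r : ℂ) ^ 2 * s) *
      (1 / (-I * (M ^ 2 * t)) ^ (1 / 2 : ℂ) *
        jacobiTheta₂ ((r / M : ℝ) : ℂ) (-1 / (M ^ 2 * t)))) * h2
  rw [jacobiTheta, ← (Int.divModEquiv M).symm.tsum_eq, ← (Equiv.prodComm _ _).tsum_eq,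
    Summable.tsum_prod (by exact (Equiv.prodComm _ _).summable_iff.2 hsum'), tsum_fintype,
    Finset.sum_range, Finset.mul_sum]
  refine Finset.sum_congr rfl fun r _ => ?_
  rw [mul_left_comm, ← hclass]
  simp [Int.divModEquiv]


/-- A positive real factor can be taken out of a complex power. -/
lemma Complex.ofReal_mul_cpow {r : ℝ} (hr : 0 < r) {w : ℂ} (hw : w ≠ 0) (a : ℂ) :
    ((r : ℂ) * w) ^ a = (r : ℂ) ^ a * w ^ a := by
  have hr' : (r : ℂ) ≠ 0 := by exact_mod_cast hr.ne'
  rw [cpow_def_of_ne_zero (mul_ne_zero hr' hw), cpow_def_of_ne_zero hr', cpow_def_of_ne_zero hw,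
    log_ofReal_mul hr hw, ← exp_add, ofReal_log hr.le, add_mul]

open Complex Filter Topology in
/-- Evaluation of the quadratic Gauss sum, obtained by comparing the behaviour of the theta
function near `2 / N` with its behaviour near `-N / 2`. -/
theorem sum_exp_sq_div {N : ℕ} (hN : N ≠ 0) :
    ∑ r ∈ range N, cexp (2 * Real.pi * I * (r : ℂ) ^ 2 / N)
      = √(N : ℝ) * ((1 + I) * (1 + (-I) ^ N) / 2) := by
  have hNc : (N : ℂ) ≠ 0 := by exact_mod_cast hN
  have hNr : (0 : ℝ) < N := by positivity
  have hlim : Tendsto (fun ε : ℝ => 1 / (N ^ 2 * ε)) (𝓝[>] 0) atTop := by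
    have h : (fun ε : ℝ => 1 / (N ^ 2 * ε)) = fun ε => (1 / (N : ℝ) ^ 2) * ε⁻¹ := by
      ext ε; field_simp
    rw [h]
    exact tendsto_inv_nhdsGT_zero.const_mul_atTop (by positivity)
  let w : ℝ → ℂ := fun ε => 2 * N ^ 2 / (2 + N * ε * I)
  have hden (ε : ℝ) : (2 + N * ε * I : ℂ) ≠ 0 := fun h => by
    simpa using congrArg re h
  have hw0 (ε : ℝ) : w ε ≠ 0 := div_ne_zero (by simpa using hNc) (hden ε)
  have hwlim : Tendsto w (𝓝[>] 0) (𝓝 (((N : ℝ) ^ 2 : ℝ) : ℂ)) := by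
    have : ContinuousAt w 0 := by
      refine ContinuousAt.div (by fun_prop) (by fun_prop) (hden 0)
    have h := this.tendsto.mono_left (nhdsWithin_le_nhds (s := Set.Ioi 0))
    convert h using 2
    simp [w]
  let S : ℝ → ℂ := fun ε => ∑ r ∈ range N, cexp (Real.pi * I * (r : ℂ) ^ 2 * (2 / N)) *
    jacobiTheta₂ ((r / N : ℝ) : ℂ) (-1 / (N ^ 2 * (ε * I)))
  let T : ℝ → ℂ := fun ε => ∑ r ∈ range 2, cexp (Real.pi * I * (r : ℂ) ^ 2 * (-N / 2)) *
    jacobiTheta₂ ((r / (2 : ℕ) : ℝ) : ℂ) (-1 / ((2 : ℕ) ^ 2 * (ε * w ε * I / 4)))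
  have hS : Tendsto S (𝓝[>] 0) (𝓝 (∑ r ∈ range N, cexp (Real.pi * I * (r : ℂ) ^ 2 * (2 / N)))) := by
    refine tendsto_finsetSum _ fun r _ => ?_
    have h := tendsto_jacobiTheta₂_one (r / N : ℝ) (l := 𝓝[>] (0 : ℝ))
      (τ := fun ε => -1 / (N ^ 2 * (ε * I))) ?_
    · simpa using h.const_mul (cexp (Real.pi * I * (r : ℂ) ^ 2 * (2 / N)))
    · refine hlim.congr' ?_
      filter_upwards [self_mem_nhdsWithin] with ε hε
      have hε' : (ε : ℂ) ≠ 0 := by exact_mod_cast (ne_of_gt hε)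
      have : (-1 / (N ^ 2 * (ε * I)) : ℂ) = ((1 / (N ^ 2 * ε) : ℝ) : ℂ) * I := by
        push_cast; field_simp; simp
      rw [this, mul_I_im, ofReal_re]
  have hT : Tendsto T (𝓝[>] 0) (𝓝 (∑ r ∈ range 2, cexp (Real.pi * I * (r : ℂ) ^ 2 * (-N / 2)))) := by
    refine tendsto_finsetSum _ fun r _ => ?_
    have h := tendsto_jacobiTheta₂_one (r / (2 : ℕ) : ℝ) (l := 𝓝[>] (0 : ℝ))
      (τ := fun ε => -1 / ((2 : ℕ) ^ 2 * (ε * w ε * I / 4))) ?_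
    · simpa using h.const_mul (cexp (Real.pi * I * (r : ℂ) ^ 2 * (-N / 2)))
    · refine hlim.congr' ?_
      filter_upwards [self_mem_nhdsWithin] with ε hε
      have hε' : (ε : ℂ) ≠ 0 := by exact_mod_cast (ne_of_gt hε)
      have hd := hden ε
      have : (-1 / ((2 : ℕ) ^ 2 * (ε * w ε * I / 4)) : ℂ)
          = ((1 / (N ^ 2 * ε) : ℝ) : ℂ) * I + ((-1 / (2 * N) : ℝ) : ℂ) := by
        simp only [w]
        push_cast
        field_simp
        linear_combination -8 * I_sq
      rw [this, add_im, mul_I_im, ofReal_re, ofReal_im, add_zero]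
  have heq : ∀ᶠ ε : ℝ in 𝓝[>] 0, S ε / N =
      T ε / ((-I * (2 / N + ε * I)) ^ (1 / 2 : ℂ) * w ε ^ (1 / 2 : ℂ)) := by
    filter_upwards [self_mem_nhdsWithin] with ε (hε : 0 < ε)
    have hε' : (ε : ℂ) ≠ 0 := by exact_mod_cast (ne_of_gt hε)
    have hd := hden ε
    have him : 0 < (2 / N + ε * I : ℂ).im := by
      have : (2 / N : ℂ) = ((2 / N : ℝ) : ℂ) := by push_cast; rfl
      rw [this]; simpa using hε
    have hinv : -1 / (2 / N + ε * I : ℂ) = -N / 2 + ε * w ε * I / 4 := by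
      have : (2 / N + ε * I : ℂ) = (2 + N * ε * I) / N := by field_simp
      rw [this]
      simp only [w]
      field_simp
      ring
    have him2 : 0 < (-N / 2 + ε * w ε * I / 4 : ℂ).im := by
      rw [← hinv, neg_div, neg_im, one_div, inv_im, neg_div, neg_neg]
      exact div_pos him (normSq_pos.2 fun h => by simp [h] at him)
    have him3 : 0 < (ε * w ε * I / 4 : ℂ).im := by
      have : (-N / 2 : ℂ) = ((-N / 2 : ℝ) : ℂ) := by push_cast; rfl
      rwa [this, add_im, ofReal_im, zero_add] at him2
    have h1 := jacobiTheta_add_of_periodic hN (s := 2 / N) (t := ε * I) (by simpa using hε) him ?_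
    have h2 := jacobiTheta_add_of_periodic two_ne_zero (s := -N / 2) (t := ε * w ε * I / 4)
      him3 him2 ?_
    · have h3 := jacobiTheta₂_functional_equation 0 (2 / N + ε * I)
      rw [zero_div, ← jacobiTheta_eq_jacobiTheta₂, ← jacobiTheta_eq_jacobiTheta₂, hinv, h1, h2] at h3
      have e1 : (-I * (N ^ 2 * (ε * I)) : ℂ) = ε * (N : ℂ) ^ 2 := by
        linear_combination (-(N : ℂ) ^ 2 * ε) * I_sq
      have e2 : (-I * ((2 : ℕ) ^ 2 * (ε * w ε * I / 4)) : ℂ) = ε * w ε := by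
        push_cast
        linear_combination (-(ε : ℂ) * w ε) * I_sq
      have e3 : ((N : ℂ) ^ 2) ^ (1 / 2 : ℂ) = N := by
        rw [one_div]; exact sq_cpow_two_inv (by simpa using hNr)
      have e4 : (ε : ℂ) ^ (1 / 2 : ℂ) ≠ 0 := by simp [cpow_eq_zero_iff, hε']
      rw [e1, e2, ofReal_mul_cpow hε (pow_ne_zero 2 hNc), ofReal_mul_cpow hε (hw0 ε), e3] at h3
      have h4 := congrArg (fun z => (ε : ℂ) ^ (1 / 2 : ℂ) * z) h3
      simp only [ne_eq, OfNat.ofNat_ne_zero, not_false_eq_true, zero_pow, mul_zero, zero_div,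
        Complex.exp_zero, mul_one] at h4
      calc S ε / N = (ε : ℂ) ^ (1 / 2 : ℂ) * (1 / ((ε : ℂ) ^ (1 / 2 : ℂ) * N) * S ε) := by
            field_simp
        _ = _ := h4
        _ = (ε : ℂ) ^ (1 / 2 : ℂ) * (1 / (-I * (2 / N + ε * I)) ^ (1 / 2 : ℂ) *
              (1 / ((ε : ℂ) ^ (1 / 2 : ℂ) * w ε ^ (1 / 2 : ℂ)) * T ε)) := rfl
        _ = _ := by field_simp
    · intro n r
      rw [exp_eq_exp_iff_exists_int]
      exact ⟨-N * (n ^ 2 + n * r), by push_cast; ring⟩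
    · intro n r
      rw [exp_eq_exp_iff_exists_int]
      exact ⟨N * n ^ 2 + 2 * n * r, by push_cast; field_simp; ring⟩
  have hτlim : Tendsto (fun ε : ℝ => (-I * (2 / N + ε * I) : ℂ)) (𝓝[>] 0) (𝓝 (-I * (2 / N))) := by
    have : Continuous fun ε : ℝ => (-I * (2 / N + ε * I) : ℂ) := by fun_prop
    simpa using (this.tendsto 0).mono_left (nhdsWithin_le_nhds (s := Set.Ioi 0))
  have hbase : (-I * (2 / N) : ℂ) = ((1 / N : ℝ) : ℂ) * (1 - I) ^ 2 := by
    push_cast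
    linear_combination (-1 / (N : ℂ)) * I_sq
  have hbase0 : (1 - I : ℂ) ≠ 0 := fun h => by simpa using congrArg re h
  have hroot : (-I * (2 / N) : ℂ) ^ (1 / 2 : ℂ) = (√(1 / N : ℝ) : ℂ) * (1 - I) := by
    rw [hbase, ofReal_mul_cpow (by positivity) (pow_ne_zero 2 hbase0), Real.sqrt_eq_rpow,
      ofReal_cpow (by positivity)]
    congr 1
    · push_cast; rfl
    · rw [one_div]; exact sq_cpow_two_inv (by simp)
  have hslit : (-I * (2 / N) : ℂ) ∈ slitPlane := by
    right
    have : (-I * (2 / N) : ℂ) = ((-2 / N : ℝ) : ℂ) * I := by push_cast; ring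
    rw [this, mul_I_im, ofReal_re]
    exact div_ne_zero (by norm_num) hNr.ne'
  have hwroot : (((N : ℝ) ^ 2 : ℝ) : ℂ) ^ (1 / 2 : ℂ) = N := by
    rw [one_div]; push_cast; exact sq_cpow_two_inv (by simpa using hNr)
  have hR := (hT.div ((hτlim.cpow tendsto_const_nhds hslit).mul
    (hwlim.cpow (tendsto_const_nhds (x := (1 / 2 : ℂ)))
      (ofReal_mem_slitPlane.2 (by positivity)))) (by
        rw [hroot, hwroot]
        have : (√(1 / N : ℝ) : ℂ) ≠ 0 := by
          exact_mod_cast (Real.sqrt_pos.2 (by positivity : (0 : ℝ) < 1 / N)).ne'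
        exact mul_ne_zero (mul_ne_zero this hbase0) hNc)).congr' (heq.mono fun ε h => h.symm)
  have hmain := tendsto_nhds_unique (hS.div_const (N : ℂ)) hR
  rw [hroot, hwroot] at hmain
  have hI : cexp (Real.pi * I * (-N / 2)) = (-I) ^ N := by
    rw [show (Real.pi * I * (-N / 2) : ℂ) = N * (-Real.pi / 2 * I) by ring, Complex.exp_nat_mul,
      Complex.exp_neg_pi_div_two_mul_I]
  have hsq : (√(N : ℝ) : ℂ) * (√(1 / N : ℝ) : ℂ) = 1 := by
    rw [← ofReal_mul, ← Real.sqrt_mul hNr.le, mul_one_div_cancel hNr.ne', Real.sqrt_one, ofReal_one]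
  have hsq0 : (√(1 / N : ℝ) : ℂ) ≠ 0 := right_ne_zero_of_mul_eq_one hsq
  have hG : ∑ r ∈ range N, cexp (2 * Real.pi * I * (r : ℂ) ^ 2 / N)
      = ∑ r ∈ range N, cexp (Real.pi * I * (r : ℂ) ^ 2 * (2 / N)) :=
    sum_congr rfl fun r _ => by congr 1; ring
  simp only [sum_range_succ, sum_range_zero, Nat.cast_zero, Nat.cast_one, one_pow, mul_one, zero_add,
    ne_eq, OfNat.ofNat_ne_zero, not_false_eq_true, zero_pow, mul_zero, zero_mul,
    Complex.exp_zero, hI] at hmain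
  rw [hG]
  have hmain' : (∑ r ∈ range N, cexp (Real.pi * I * (r : ℂ) ^ 2 * (2 / N))) *
      (√(1 / N : ℝ) * (1 - I)) = 1 + (-I) ^ N := by
    rw [div_eq_div_iff hNc (mul_ne_zero (mul_ne_zero hsq0 hbase0) hNc)] at hmain
    exact mul_right_cancel₀ hNc (by linear_combination hmain)
  generalize ∑ r ∈ range N, cexp (Real.pi * I * (r : ℂ) ^ 2 * (2 / N)) = G at *
  linear_combination (√(N : ℝ) * (1 + I) / 2 : ℂ) * hmain' - G * hsq +
    (√(N : ℝ) * √(1 / N : ℝ) * G / 2 : ℂ) * I_sq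

open Complex in
/-- Sums over `range N` of `N`-th roots of unity as sums over `ZMod N`. -/
lemma sum_range_exp_eq_sum_zmod (N : ℕ) [NeZero N] (c : ℤ) :
    ∑ m ∈ range N, cexp (2 * Real.pi * I * c * (m : ℂ) ^ 2 / N)
      = ∑ x : ZMod N, ZMod.stdAddChar ((c : ZMod N) * x ^ 2) := by
  refine Finset.sum_bij' (fun m _ => (m : ZMod N)) (fun x _ => x.val) (by simp)
    (fun x _ => mem_range.2 x.val_lt) (fun m hm => ZMod.val_cast_of_lt (mem_range.1 hm))
    (by simp) fun m _ => ?_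
  have := ZMod.stdAddChar_coe (N := N) (c * (m : ℤ) ^ 2)
  push_cast at this
  rw [this]
  congr 1
  ring

/-- In a finite field of odd characteristic, scaling the variable of the quadratic Gauss sum by
`a ≠ 0` multiplies it by the quadratic character of `a`. -/
lemma sum_addChar_mul_sq {F : Type*} [Field F] [Fintype F] [DecidableEq F] (hF : ringChar F ≠ 2)
    {ψ : AddChar F ℂ} (hψ : ψ.IsPrimitive) {a : F} (ha : a ≠ 0) :
    ∑ x, ψ (a * x ^ 2) = quadraticChar F a * ∑ x, ψ (x ^ 2) := by
  have key (b : F) (hb : b ≠ 0) : ∑ x, ψ (b * x ^ 2)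
      = gaussSum ((quadraticChar F).ringHomComp (Int.castRingHom ℂ)) (ψ.mulShift b) := by
    have h1 : ∑ x, ψ (b * x ^ 2) = ∑ y, ((quadraticChar F y + 1 : ℤ) : ℂ) * ψ (b * y) := by
      rw [← Finset.sum_fiberwise (s := univ) (g := fun x : F => x ^ 2)]
      refine Finset.sum_congr rfl fun y _ => ?_
      rw [← quadraticChar_card_sqrts hF y, Finset.sum_congr rfl (g := fun _ => ψ (b * y))
        fun x hx => by rw [(mem_filter.1 hx).2], Finset.sum_const, nsmul_eq_mul]
      congr 3
      ext; simp
    have h2 : ∑ y, ψ (b * y) = 0 := by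
      simpa [hb, mul_comm] using AddChar.sum_mulShift b hψ
    simp [h1, gaussSum, add_mul, Finset.sum_add_distrib, h2]
  have h := gaussSum_mulShift ((quadraticChar F).ringHomComp (Int.castRingHom ℂ)) ψ (Units.mk0 a ha)
  have h1 := key 1 one_ne_zero
  rw [AddChar.mulShift_one] at h1
  simp only [one_mul] at h1
  rw [h1, ← h, Units.val_mk0, ← key a ha]
  have hsq : ((quadraticChar F a : ℤ) : ℂ) ^ 2 = 1 := by
    exact_mod_cast quadraticChar_sq_one ha
  simp only [MulChar.ringHomComp_apply, eq_intCast]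
  linear_combination -(∑ x, ψ (a * x ^ 2)) * hsq

open Complex in
/-- The Gauss sum modulo `p ^ (k + 2)` is `p` times the one modulo `p ^ k`. -/
lemma sum_exp_prime_pow_add_two (p : ℕ) [Fact p.Prime] (hp : p ≠ 2) (k : ℕ)
    (c : ℤ) (hc : ¬ (p : ℤ) ∣ c) :
    ∑ m ∈ range (p ^ (k + 2)), cexp (2 * Real.pi * I * c * (m : ℂ) ^ 2 / (p : ℂ) ^ (k + 2))
      = p * ∑ m ∈ range (p ^ k), cexp (2 * Real.pi * I * c * (m : ℂ) ^ 2 / (p : ℂ) ^ k) := by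
  have hprime : p.Prime := Fact.out
  have hp0 : (p : ℂ) ≠ 0 := by exact_mod_cast hprime.ne_zero
  have hsplit {A B : ℕ} (hA : 0 < A) (f : ℕ → ℂ) :
      ∑ m ∈ range (A * B), f m = ∑ a ∈ range A, ∑ b ∈ range B, f (a + A * b) := by
    rw [← Finset.sum_product']
    symm
    refine Finset.sum_bij' (fun x _ => x.1 + A * x.2) (fun m _ => (m % A, m / A)) ?_ ?_ ?_ ?_ ?_
    · rintro ⟨a, b⟩ h
      simp only [mem_product, mem_range] at h ⊢
      nlinarith
    · intro m hm
      simp only [mem_product, mem_range] at hm ⊢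
      exact ⟨Nat.mod_lt _ hA, Nat.div_lt_of_lt_mul hm⟩
    · rintro ⟨a, b⟩ h
      simp only [mem_product, mem_range] at h
      simp [Nat.add_mul_mod_self_left, Nat.mod_eq_of_lt h.1, Nat.add_mul_div_left _ _ hA,
        Nat.div_eq_of_lt h.1]
    · intro m _
      exact Nat.mod_add_div m A
    · simp
  have hpoint (a b : ℕ) :
      cexp (2 * Real.pi * I * c * ((a + p ^ (k + 1) * b : ℕ) : ℂ) ^ 2 / (p : ℂ) ^ (k + 2))
      = cexp (2 * Real.pi * I * c * (a : ℂ) ^ 2 / (p : ℂ) ^ (k + 2)) *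
        ZMod.stdAddChar ((b : ZMod p) * ((2 * c * a : ℤ) : ZMod p)) := by
    have := ZMod.stdAddChar_coe (N := p) (b * (2 * c * a))
    rw [Int.cast_mul, Int.cast_natCast] at this
    rw [this, ← Complex.exp_add, exp_eq_exp_iff_exists_int]
    refine ⟨c * p ^ k * b ^ 2, ?_⟩
    push_cast
    field_simp
    ring
  have hinner (a : ℕ) : ∑ b ∈ range p,
      cexp (2 * Real.pi * I * c * ((a + p ^ (k + 1) * b : ℕ) : ℂ) ^ 2 / (p : ℂ) ^ (k + 2))
      = if p ∣ a then p * cexp (2 * Real.pi * I * c * (a : ℂ) ^ 2 / (p : ℂ) ^ (k + 2)) else 0 := by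
    have hz : ((2 * c * a : ℤ) : ZMod p) = 0 ↔ p ∣ a := by
      have h2 : ¬ (p : ℤ) ∣ 2 := fun h => hp ((Nat.prime_dvd_prime_iff_eq hprime Nat.prime_two).1
        (by exact_mod_cast h))
      rw [ZMod.intCast_zmod_eq_zero_iff_dvd, (Nat.prime_iff_prime_int.1 hprime).dvd_mul,
        (Nat.prime_iff_prime_int.1 hprime).dvd_mul]
      simp [h2, hc, Int.natCast_dvd_natCast]
    have hsum : ∑ b ∈ range p, ZMod.stdAddChar ((b : ZMod p) * ((2 * c * a : ℤ) : ZMod p))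
        = if p ∣ a then (p : ℂ) else 0 := by
      have h := AddChar.sum_mulShift ((2 * c * a : ℤ) : ZMod p) (ZMod.isPrimitive_stdAddChar p)
      simp only [hz, ZMod.card] at h
      push_cast at h
      rw [← h]
      refine Finset.sum_bij' (fun m _ => (m : ZMod p)) (fun x _ => x.val) (by simp)
        (fun x _ => mem_range.2 x.val_lt) (fun m hm => ZMod.val_cast_of_lt (mem_range.1 hm))
        (by simp) fun m _ => ?_
      push_cast
      rfl
    simp_rw [hpoint, ← Finset.mul_sum, hsum]
    split_ifs <;> ring
  rw [show p ^ (k + 2) = p ^ (k + 1) * p by ring, hsplit (by positivity [hprime.pos])]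
  simp_rw [hinner]
  rw [show p ^ (k + 1) = p * p ^ k by ring, hsplit hprime.pos, Finset.sum_comm, Finset.mul_sum]
  refine Finset.sum_congr rfl fun b _ => ?_
  rw [Finset.sum_eq_single_of_mem 0 (mem_range.2 hprime.pos)]
  · simp only [zero_add, dvd_mul_right, if_true]
    congr 2
    push_cast
    field_simp
    ring
  · intro a ha ha0
    rw [if_neg]
    rw [(Nat.dvd_add_left (dvd_mul_right p b))]
    exact Nat.not_dvd_of_pos_of_lt (Nat.pos_of_ne_zero ha0) (mem_range.1 ha)

open Complex in
/-- The quadratic Gauss sum modulo an odd prime, with its sign. -/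
lemma sum_exp_prime (p : ℕ) [Fact p.Prime] (hp : p ≠ 2) (c : ℤ) (hc : ¬ (p : ℤ) ∣ c) (η : ℕ)
    (hleg : legendreSym p (2 * c) = (-1) ^ η) :
    ∑ m ∈ range p, cexp (2 * Real.pi * I * c * (m : ℂ) ^ 2 / p)
      = √(p : ℝ) * cexp (2 * Real.pi * I * ((1 - p + 4 * η : ℤ) : ℂ) / 8) := by
  have hprime : p.Prime := Fact.out
  have hc' : (c : ZMod p) ≠ 0 := by rwa [ne_eq, ZMod.intCast_zmod_eq_zero_iff_dvd]
  have hone := sum_range_exp_eq_sum_zmod p 1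
  simp only [Int.cast_one, mul_one, one_mul] at hone
  rw [sum_range_exp_eq_sum_zmod, sum_addChar_mul_sq (by rwa [ZMod.ringChar_zmod_n])
    (ZMod.isPrimitive_stdAddChar p) hc', ← hone, sum_exp_sq_div hprime.ne_zero]
  have hcleg : quadraticChar (ZMod p) c = ZMod.χ₈ p * (-1) ^ η := by
    have h2 := legendreSym.at_two hp
    have h2sq : legendreSym p 2 ^ 2 = 1 := legendreSym.sq_one p (by
      exact_mod_cast Ring.two_ne_zero (R := ZMod p) (by rwa [ZMod.ringChar_zmod_n]))
    rw [legendreSym.mul] at hleg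
    rw [← hleg, ← h2, ← mul_assoc, ← sq, h2sq, one_mul]
    rfl
  have hη : cexp (2 * Real.pi * I * ((1 - p + 4 * η : ℤ) : ℂ) / 8)
      = cexp (2 * Real.pi * I * (1 - p) / 8) * (-1) ^ η := by
    rw [← exp_pi_mul_I, ← Complex.exp_nat_mul, ← Complex.exp_add]
    congr 1
    push_cast
    ring
  have hodd : p % 2 = 1 := Nat.odd_iff.1 (hprime.odd_of_ne_two hp)
  have hmod8 : ((ZMod.χ₈ p : ℤ) : ℂ) * ((1 + I) * (1 + (-I) ^ p) / 2)
      = cexp (2 * Real.pi * I * (1 - p) / 8) := by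
    obtain ⟨q, r, hr, hpq⟩ : ∃ q r : ℕ, r < 8 ∧ p = 8 * q + r :=
      ⟨p / 8, p % 8, Nat.mod_lt _ (by norm_num), (Nat.div_add_mod p 8).symm⟩
    have hI8 : (-I) ^ p = (-I) ^ r := by
      rw [hpq, pow_add, pow_mul, show (-I) ^ 8 = (1 : ℂ) by
        rw [neg_pow, show (8 : ℕ) = 4 * 2 by rfl, pow_mul I, I_pow_four]; norm_num]
      simp
    have hχ : ZMod.χ₈ (p : ZMod 8) = ZMod.χ₈ (r : ZMod 8) := by
      congr 1
      rw [hpq]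
      push_cast
      rw [show (8 : ZMod 8) = 0 by rfl]
      ring
    have hexp : cexp (2 * Real.pi * I * (1 - p) / 8) = cexp (Real.pi / 2 * I * ((1 - r) / 2)) := by
      rw [exp_eq_exp_iff_exists_int]
      exact ⟨-q, by rw [hpq]; push_cast; ring⟩
    rw [hI8, hχ, hexp]
    have hrodd : r % 2 = 1 := by omega
    interval_cases r <;> try omega
    · rw [show ZMod.χ₈ ((1 : ℕ) : ZMod 8) = 1 by decide]
      simp
      linear_combination (-1 / 2 : ℂ) * I_sq
    · rw [show ZMod.χ₈ ((3 : ℕ) : ZMod 8) = -1 by decide,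
        show (Real.pi / 2 * I * ((1 - (3 : ℕ)) / 2) : ℂ) = -Real.pi / 2 * I by push_cast; ring,
        exp_neg_pi_div_two_mul_I]
      push_cast
      linear_combination ((1 / 2 : ℂ) * (I + I ^ 2) - 1 / 2) * I_sq
    · rw [show ZMod.χ₈ ((5 : ℕ) : ZMod 8) = -1 by decide,
        show (Real.pi / 2 * I * ((1 - (5 : ℕ)) / 2) : ℂ) = -(Real.pi * I) by push_cast; ring,
        Complex.exp_neg, exp_pi_mul_I, show (-I) ^ 5 = -I by
          linear_combination (-I ^ 3 + I) * I_sq]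
      push_cast
      linear_combination (1 / 2 : ℂ) * I_sq
    · rw [show ZMod.χ₈ ((7 : ℕ) : ZMod 8) = 1 by decide,
        show (Real.pi / 2 * I * ((1 - (7 : ℕ)) / 2) : ℂ) = -(Real.pi * I) + -Real.pi / 2 * I by
          push_cast; ring,
        Complex.exp_add, exp_neg_pi_div_two_mul_I, Complex.exp_neg, exp_pi_mul_I,
        show (-I) ^ 7 = I by linear_combination (-I ^ 5 + I ^ 3 - I) * I_sq]
      push_cast
      linear_combination (1 / 2 : ℂ) * I_sq
  rw [hη, ← hmod8, hcleg]
  push_cast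
  ring

open Complex in
/-- The quadratic Gauss sum modulo an even power of an odd prime. -/
lemma sum_exp_prime_pow_even (p : ℕ) [Fact p.Prime] (hp : p ≠ 2) (j : ℕ)
    (c : ℤ) (hc : ¬ (p : ℤ) ∣ c) :
    ∑ m ∈ range (p ^ (2 * j)), cexp (2 * Real.pi * I * c * (m : ℂ) ^ 2 / (p : ℂ) ^ (2 * j))
      = (p : ℂ) ^ j := by
  induction j with
  | zero => simp
  | succ j ih => rw [Nat.mul_succ, sum_exp_prime_pow_add_two p hp _ c hc, ih, pow_succ']

open Complex in
/-- The quadratic Gauss sum modulo an odd power of an odd prime. -/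
lemma sum_exp_prime_pow_odd (p : ℕ) [Fact p.Prime] (hp : p ≠ 2) (j : ℕ)
    (c : ℤ) (hc : ¬ (p : ℤ) ∣ c) :
    ∑ m ∈ range (p ^ (2 * j + 1)), cexp (2 * Real.pi * I * c * (m : ℂ) ^ 2 / (p : ℂ) ^ (2 * j + 1))
      = (p : ℂ) ^ j * ∑ m ∈ range p, cexp (2 * Real.pi * I * c * (m : ℂ) ^ 2 / p) := by
  induction j with
  | zero => simp
  | succ j ih =>
    rw [show 2 * (j + 1) + 1 = 2 * j + 1 + 2 by ring, sum_exp_prime_pow_add_two p hp _ c hc, ih,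
      pow_succ', mul_assoc (p : ℂ)]

/-- The Gauss-sum form of `sign q_θ^{(p)}(p^k) ≡ k²(1-p) + 4kη (mod 8)` for an odd prime `p`,
where `(θ/p) = (-1)^η`. -/
theorem sign_q_odd_p (p : ℕ) [Fact p.Prime] (hp : p ≠ 2) (k : ℕ) (hk : 1 ≤ k)
    (c : ℤ) (hc : ¬ (p : ℤ) ∣ c) (η : ℕ) (hη : η = 0 ∨ η = 1)
    (hleg : legendreSym p (2 * c) = (-1) ^ η) :
    ∑ m ∈ Finset.range (p ^ k),
        Complex.exp (2 * Real.pi * Complex.I * (c : ℂ) * (m : ℂ) ^ 2 / (p : ℂ) ^ k)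
      = (Real.sqrt ((p : ℝ) ^ k) : ℂ) *
        Complex.exp (2 * Real.pi * Complex.I *
          (((k : ℤ) ^ 2 * (1 - (p : ℤ)) + 4 * (k : ℤ) * (η : ℤ) : ℤ) : ℂ) / 8) := by
  have hprime : p.Prime := Fact.out
  obtain ⟨q, hq⟩ := hprime.odd_of_ne_two hp
  have hp0 : (0 : ℝ) ≤ p := p.cast_nonneg
  rcases Nat.even_or_odd' k with ⟨j, rfl | rfl⟩
  · have h1 : Complex.exp (2 * Real.pi * Complex.I *
        ((((2 * j : ℕ) : ℤ) ^ 2 * (1 - (p : ℤ)) + 4 * ((2 * j : ℕ) : ℤ) * (η : ℤ) : ℤ) : ℂ) / 8)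
        = 1 := by
      rw [Complex.exp_eq_one_iff]
      exact ⟨-j ^ 2 * q + j * η, by rw [hq]; push_cast; ring⟩
    rw [sum_exp_prime_pow_even p hp j c hc, h1, mul_one, pow_mul', Real.sqrt_sq (by positivity)]
    push_cast
    rfl
  · obtain ⟨i, hi⟩ := Nat.even_mul_succ_self j
    have hi' : (j : ℂ) * (j + 1) = i + i := by exact_mod_cast hi
    have h1 : Complex.exp (2 * Real.pi * Complex.I *
        ((((2 * j + 1 : ℕ) : ℤ) ^ 2 * (1 - (p : ℤ)) + 4 * ((2 * j + 1 : ℕ) : ℤ) * (η : ℤ) : ℤ) : ℂ)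
          / 8) = Complex.exp (2 * Real.pi * Complex.I * ((1 - p + 4 * η : ℤ) : ℂ) / 8) := by
      rw [Complex.exp_eq_exp_iff_exists_int]
      refine ⟨-2 * i * q + j * η, ?_⟩
      rw [hq]
      push_cast
      linear_combination (-2 * Real.pi * Complex.I * q) * hi'
    rw [sum_exp_prime_pow_odd p hp j c hc, h1, sum_exp_prime p hp c hc η hleg, pow_succ, pow_mul',
      Real.sqrt_mul (by positivity), Real.sqrt_sq (by positivity)]
    push_cast
    ring
end

section
/- Let k ≥ 1 be a natural number and let θ be an odd integer; set ω(θ) = (θ² − 1)/8 taken mod 2 (so ω(θ) ∈ {0,1}, and ω(θ) = 1 exactly when θ ≡ ±3 mod 8). Then ∑_{m=0}^{2^k − 1} exp(πi·θ·m²/2^k) = 2^{k/2} · exp(2πi·(θ + 4·ω(θ)·k)/8). (Equivalently, the signature mod 8 of the finite quadratic form q_θ^{(2)}(2^k) is θ + 4ω(θ)k mod 8.) -/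
open Finset

/-- The exponential `exp (x + n * π i)` equals `exp x` for even `n`. -/
lemma exp_add_even_mul_pi_mul_I (x : ℂ) {n : ℤ} (hn : Even n) :
    Complex.exp (x + n * (Real.pi * Complex.I)) = Complex.exp x := by
  rw [Complex.exp_add, Complex.exp_int_mul, Complex.exp_pi_mul_I, hn.neg_one_zpow, mul_one]

/-- The exponential `exp (x + n * π i)` equals `-exp x` for odd `n`. -/
lemma exp_add_odd_mul_pi_mul_I (x : ℂ) {n : ℤ} (hn : Odd n) :
    Complex.exp (x + n * (Real.pi * Complex.I)) = -Complex.exp x := by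
  rw [Complex.exp_add, Complex.exp_int_mul, Complex.exp_pi_mul_I, hn.neg_one_zpow, mul_neg_one]

/-- Splitting a sum of even length into its even-indexed and odd-indexed terms. -/
lemma sum_range_two_mul_eq_even_add_odd (f : ℕ → ℂ) (N : ℕ) :
    ∑ m ∈ range (2 * N), f m = ∑ n ∈ range N, f (2 * n) + ∑ n ∈ range N, f (2 * n + 1) := by
  induction N with
  | zero => simp
  | succ N ih =>
    rw [show 2 * (N + 1) = 2 * N + 1 + 1 by ring, sum_range_succ, sum_range_succ, ih,
      sum_range_succ, sum_range_succ]
    ring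

/-- The quadratic Gauss sum modulo `2 ^ (k + 2)` is twice the one modulo `2 ^ k`. -/
lemma gaussSum_two_pow_add_two {k : ℕ} (hk : 1 ≤ k) {θ : ℤ} (hθ : Odd θ) :
    ∑ m ∈ range (2 ^ (k + 2)),
        Complex.exp (Real.pi * Complex.I * (θ : ℂ) * (m : ℂ) ^ 2 / (2 : ℂ) ^ (k + 2))
      = 2 * ∑ m ∈ range (2 ^ k),
        Complex.exp (Real.pi * Complex.I * (θ : ℂ) * (m : ℂ) ^ 2 / (2 : ℂ) ^ k) := by
  have h2 : (2 : ℂ) ^ k ≠ 0 := pow_ne_zero k two_ne_zero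
  have hev : Even ((2 : ℤ) ^ k) := (even_two).pow_of_ne_zero (by omega)
  rw [show 2 ^ (k + 2) = 2 * (2 ^ k + 2 ^ k) by ring, sum_range_two_mul_eq_even_add_odd,
    sum_range_add, sum_range_add, two_mul]
  have heven : ∀ n : ℕ,
      Complex.exp (Real.pi * Complex.I * θ * ((2 * n : ℕ) : ℂ) ^ 2 / 2 ^ (k + 2)) =
        Complex.exp (Real.pi * Complex.I * θ * (n : ℂ) ^ 2 / 2 ^ k) := by
    intro n
    congr 1
    push_cast
    field_simp
    ring
  have hshift : ∀ n : ℕ,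
      Complex.exp (Real.pi * Complex.I * θ * ((2 ^ k + n : ℕ) : ℂ) ^ 2 / 2 ^ k) =
        Complex.exp (Real.pi * Complex.I * θ * (n : ℂ) ^ 2 / 2 ^ k) := by
    intro n
    refine Eq.trans ?_ (exp_add_even_mul_pi_mul_I _
      (show Even (θ * (2 * n + 2 ^ k)) from ((even_two_mul _).add hev).mul_left θ))
    congr 1
    push_cast
    field_simp
    ring
  have hodd : ∀ n : ℕ,
      Complex.exp (Real.pi * Complex.I * θ * ((2 * (2 ^ k + n) + 1 : ℕ) : ℂ) ^ 2 / 2 ^ (k + 2)) =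
        -Complex.exp (Real.pi * Complex.I * θ * ((2 * n + 1 : ℕ) : ℂ) ^ 2 / 2 ^ (k + 2)) := by
    intro n
    rw [← exp_add_odd_mul_pi_mul_I _
      (show Odd (θ * (2 ^ k + (2 * n + 1))) from hθ.mul (hev.add_odd (odd_two_mul_add_one _)))]
    congr 1
    push_cast
    field_simp
    ring
  simp only [heven, hshift, hodd, sum_neg_distrib]
  ring

/-- The square root of two in terms of a primitive eighth root of unity. -/
lemma sqrt_two_eq_exp_sub_exp_pow_three :
    (Real.sqrt 2 : ℂ) = Complex.exp (Real.pi * Complex.I / 4)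
      - Complex.exp (Real.pi * Complex.I / 4) ^ 3 := by
  have h : Complex.exp (Real.pi * Complex.I / 4) =
      (Real.sqrt 2 / 2 : ℝ) + (Real.sqrt 2 / 2 : ℝ) * Complex.I := by
    rw [show (Real.pi * Complex.I / 4 : ℂ) = ((Real.pi / 4 : ℝ) : ℂ) * Complex.I by
      push_cast; ring, Complex.exp_mul_I, ← Complex.ofReal_cos, ← Complex.ofReal_sin,
      Real.cos_pi_div_four, Real.sin_pi_div_four]
  have hs : (Real.sqrt 2 : ℂ) ^ 2 = 2 := by
    rw [← Complex.ofReal_pow, Real.sq_sqrt (by norm_num)]; norm_num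
  rw [h]
  push_cast
  linear_combination (Real.sqrt 2 * (Complex.I - 1) / 4 : ℂ) * hs +
    (Real.sqrt 2 ^ 3 * (3 + Complex.I) / 8 : ℂ) * Complex.I_sq

/-- The quadratic Gauss sum modulo `2`. -/
lemma one_add_exp_eq_sqrt_two_mul_exp {θ : ℤ} (hθ : Odd θ) :
    1 + Complex.exp (Real.pi * Complex.I * (θ : ℂ) / 2) =
      (Real.sqrt 2 : ℂ) * Complex.exp (2 * Real.pi * Complex.I *
        ((θ + 4 * (((θ ^ 2 - 1) / 8) % 2) : ℤ) : ℂ) / 8) := by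
  set ζ := Complex.exp (Real.pi * Complex.I / 4) with hζ
  have hζ0 : ζ ≠ 0 := Complex.exp_ne_zero _
  have h4 : ζ ^ 4 = -1 := by
    rw [hζ, ← Complex.exp_nat_mul, ← Complex.exp_pi_mul_I]
    congr 1
    push_cast
    ring
  have h8 : ζ ^ (8 : ℤ) = 1 := by
    rw [show (8 : ℤ) = ((8 : ℕ) : ℤ) by rfl, zpow_natCast]
    linear_combination (ζ ^ 4 - 1) * h4
  have hz : ∀ n : ℤ, Complex.exp (2 * Real.pi * Complex.I * (n : ℂ) / 8) = ζ ^ n := by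
    intro n
    rw [hζ, ← Complex.exp_int_mul]
    congr 1
    ring
  have hper : ∀ (n : ℕ) (q : ℤ), ζ ^ (n + 8 * q) = ζ ^ n := by
    intro n q
    rw [zpow_add₀ hζ0, zpow_mul, h8, one_zpow, mul_one, zpow_natCast]
  rw [show Real.pi * Complex.I * (θ : ℂ) / 2 =
    2 * Real.pi * Complex.I * ((2 * θ : ℤ) : ℂ) / 8 by push_cast; ring, hz, hz,
    sqrt_two_eq_exp_sub_exp_pow_three, ← hζ]
  obtain ⟨q, hq⟩ : ∃ q, θ = 8 * q + 1 ∨ θ = 8 * q + 3 ∨ θ = 8 * q + 5 ∨ θ = 8 * q + 7 := by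
    obtain ⟨n, rfl⟩ := hθ
    exact ⟨n / 4, by omega⟩
  have key : ∀ (r w : ℕ) (c : ℤ), θ = 8 * q + r → θ ^ 2 - 1 = 8 * (2 * c + w) → w < 2 →
      1 + ζ ^ (2 * r) = (ζ - ζ ^ 3) * ζ ^ (r + 4 * w) →
      1 + ζ ^ (2 * θ) = (ζ - ζ ^ 3) * ζ ^ (θ + 4 * ((θ ^ 2 - 1) / 8 % 2)) := by
    intro r w c hr hc hw h
    have hω : (θ ^ 2 - 1) / 8 % 2 = w := by omega
    rw [hω, show 2 * θ = ((2 * r : ℕ) : ℤ) + 8 * (2 * q) by push_cast; linarith,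
      show θ + 4 * (w : ℤ) = ((r + 4 * w : ℕ) : ℤ) + 8 * q by push_cast; linarith, hper, hper, h]
  rcases hq with h | h | h | h
  · exact key 1 0 (4 * q ^ 2 + q) (by simpa using h) (by rw [h]; push_cast; ring) (by norm_num)
      (by linear_combination h4)
  · exact key 3 1 (4 * q ^ 2 + 3 * q) (by simpa using h) (by rw [h]; push_cast; ring)
      (by norm_num) (by linear_combination (ζ ^ 6 - ζ ^ 4 + 1) * h4)
  · exact key 5 1 (4 * q ^ 2 + 5 * q + 1) (by simpa using h) (by rw [h]; push_cast; ring)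
      (by norm_num) (by linear_combination (ζ ^ 8 - ζ ^ 4 + 1) * h4)
  · exact key 7 0 (4 * q ^ 2 + 7 * q + 3) (by simpa using h) (by rw [h]; push_cast; ring)
      (by norm_num) (by linear_combination (ζ ^ 10 - ζ ^ 4 + 1) * h4)

/-- The Gauss-sum form of `sign q_θ^{(2)}(2^k) ≡ θ + 4ω(θ)k (mod 8)` for odd `θ`,
where `ω(θ) ≡ (θ² - 1)/8 (mod 2)`. -/
theorem sign_q_two (k : ℕ) (hk : 1 ≤ k) (θ : ℤ) (hθ : Odd θ) :
    ∑ m ∈ Finset.range (2 ^ k),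
        Complex.exp (Real.pi * Complex.I * (θ : ℂ) * (m : ℂ) ^ 2 / (2 : ℂ) ^ k)
      = (Real.sqrt ((2 : ℝ) ^ k) : ℂ) *
        Complex.exp (2 * Real.pi * Complex.I *
          ((θ + 4 * (((θ ^ 2 - 1) / 8) % 2) * (k : ℤ) : ℤ) : ℂ) / 8) := by
  induction k using Nat.strong_induction_on with
  | _ k ih =>
    match k, hk with
    | 1, _ =>
      simpa [sum_range_succ] using one_add_exp_eq_sqrt_two_mul_exp hθ
    | 2, _ =>
      have hsqrt : Real.sqrt ((2 : ℝ) ^ 2) = 2 := Real.sqrt_sq (by norm_num)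
      have h0 : Real.pi * Complex.I * (θ : ℂ) * ((0 : ℕ) : ℂ) ^ 2 / 2 ^ 2 = 0 := by simp
      have h1 : Complex.exp (Real.pi * Complex.I * (θ : ℂ) * ((2 : ℕ) : ℂ) ^ 2 / 2 ^ 2) = -1 := by
        rw [← Complex.exp_zero, ← exp_add_odd_mul_pi_mul_I _ hθ]
        congr 1
        push_cast
        ring
      have h3 : Complex.exp (Real.pi * Complex.I * (θ : ℂ) * ((3 : ℕ) : ℂ) ^ 2 / 2 ^ 2) =
          Complex.exp (Real.pi * Complex.I * (θ : ℂ) * ((1 : ℕ) : ℂ) ^ 2 / 2 ^ 2) := by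
        refine Eq.trans ?_ (exp_add_even_mul_pi_mul_I _ (even_two_mul θ))
        congr 1
        push_cast
        ring
      have hr : Complex.exp (2 * Real.pi * Complex.I *
          ((θ + 4 * (((θ ^ 2 - 1) / 8) % 2) * ((2 : ℕ) : ℤ) : ℤ) : ℂ) / 8) =
          Complex.exp (Real.pi * Complex.I * (θ : ℂ) * ((1 : ℕ) : ℂ) ^ 2 / 2 ^ 2) := by
        refine Eq.trans ?_
          (exp_add_even_mul_pi_mul_I _ (even_two_mul (((θ ^ 2 - 1) / 8) % 2)))
        congr 1
        push_cast
        ring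
      rw [hr, hsqrt, show 2 ^ 2 = 3 + 1 by norm_num, sum_range_succ, sum_range_succ,
        sum_range_succ, sum_range_one, h0, h1, h3, Complex.exp_zero]
      push_cast
      ring
    | k + 3, _ =>
      have hsqrt : Real.sqrt ((2 : ℝ) ^ (k + 3)) = 2 * Real.sqrt ((2 : ℝ) ^ (k + 1)) := by
        rw [show (2 : ℝ) ^ (k + 3) = 2 ^ 2 * 2 ^ (k + 1) by ring, Real.sqrt_mul (by norm_num),
          Real.sqrt_sq (by norm_num)]
      rw [gaussSum_two_pow_add_two (k := k + 1) (by omega) hθ, ih (k + 1) (by omega) (by omega),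
        hsqrt, Complex.ofReal_mul, Complex.ofReal_ofNat,
        mul_assoc (2 : ℂ) (Real.sqrt ((2 : ℝ) ^ (k + 1)) : ℂ)]
      congr 2
      refine ((exp_add_even_mul_pi_mul_I _ (even_two_mul (((θ ^ 2 - 1) / 8) % 2))).symm).trans ?_
      congr 1
      push_cast
      ring
end

section
/- Let k ≥ 1 be a natural number. Then the double Gauss sum of the 2-adic form V satisfies ∑_{x=0}^{2^k − 1} ∑_{y=0}^{2^k − 1} exp(2πi·(x² + xy + y²)/2^k) = (−1)^k · 2^k. (Equivalently, the signature mod 8 of the finite quadratic form v_+^{(2)}(2^k) is 4k mod 8, while that of u_+^{(2)}(2^k) is 0.) -/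
open Finset

lemma sum_range_two_mul {M : Type*} [AddCommMonoid M] (f : ℕ → M) (n : ℕ) :
    ∑ x ∈ range (2 * n), f x = ∑ i ∈ range n, (f (2 * i) + f (2 * i + 1)) := by
  induction n with
  | zero => simp
  | succ n ih =>
    rw [Nat.mul_succ, sum_range_succ, sum_range_succ, sum_range_succ, ih, add_assoc]

/-- The additive character `n ↦ exp (2πi n / 2 ^ k)`. -/
noncomputable def dyadicChar (k n : ℕ) : ℂ :=
  Complex.exp (2 * Real.pi * Complex.I * (n : ℂ) / (2 : ℂ) ^ k)

lemma dyadicChar_add (k a b : ℕ) :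
    dyadicChar k (a + b) = dyadicChar k a * dyadicChar k b := by
  simp only [dyadicChar, ← Complex.exp_add]
  congr 1
  push_cast
  ring

lemma dyadicChar_half_mul (k m : ℕ) : dyadicChar (k + 1) (2 ^ k * m) = (-1) ^ m := by
  rw [← Complex.exp_pi_mul_I, ← Complex.exp_nat_mul, dyadicChar]
  congr 1
  push_cast
  field_simp
  ring

lemma dyadicChar_four_mul (k n : ℕ) : dyadicChar (k + 2) (4 * n) = dyadicChar k n := by
  simp only [dyadicChar]
  congr 1
  push_cast
  field_simp
  ring

/-- The Gauss sum of `x ^ 2 + x * y + y ^ 2` modulo `2 ^ k`. -/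
noncomputable def gaussSumV (k : ℕ) : ℂ :=
  ∑ x ∈ range (2 ^ k), ∑ y ∈ range (2 ^ k), dyadicChar k (x ^ 2 + x * y + y ^ 2)

/-- The sum of the character over the translates of `(u, v)` by multiples of half the modulus. -/
lemma dyadicChar_sum_translates (k u v : ℕ) :
    let h := 2 ^ (k + 1)
    dyadicChar (k + 2) (u ^ 2 + u * v + v ^ 2)
      + dyadicChar (k + 2) (u ^ 2 + u * (h + v) + (h + v) ^ 2)
      + (dyadicChar (k + 2) ((h + u) ^ 2 + (h + u) * v + v ^ 2)
      + dyadicChar (k + 2) ((h + u) ^ 2 + (h + u) * (h + v) + (h + v) ^ 2))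
      = dyadicChar (k + 2) (u ^ 2 + u * v + v ^ 2) * ((1 + (-1) ^ u) * (1 + (-1) ^ v)) := by
  intro h
  have hE (m : ℕ) : dyadicChar (k + 2) (h * m) = (-1) ^ m := dyadicChar_half_mul (k + 1) m
  have h_even : Even h := by simp [h, Nat.even_pow]
  rw [show u ^ 2 + u * (h + v) + (h + v) ^ 2
      = (u ^ 2 + u * v + v ^ 2) + h * (h + u + 2 * v) by ring,
    show (h + u) ^ 2 + (h + u) * v + v ^ 2
      = (u ^ 2 + u * v + v ^ 2) + h * (h + 2 * u + v) by ring,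
    show (h + u) ^ 2 + (h + u) * (h + v) + (h + v) ^ 2
      = (u ^ 2 + u * v + v ^ 2) + h * (3 * h + 2 * (u + v) + (u + v)) by ring]
  simp only [dyadicChar_add, hE, pow_add, pow_mul, mul_comm 3 h, h_even.neg_one_pow, one_pow,
    even_two.neg_one_pow]
  ring

lemma gaussSumV_add_two (k : ℕ) : gaussSumV (k + 2) = 4 * gaussSumV k := by
  have hN : 2 ^ (k + 2) = 2 ^ (k + 1) + 2 ^ (k + 1) := by ring
  have hH : 2 ^ (k + 1) = 2 * 2 ^ k := by ring
  have key : gaussSumV (k + 2) = ∑ u ∈ range (2 ^ (k + 1)), ∑ v ∈ range (2 ^ (k + 1)),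
      dyadicChar (k + 2) (u ^ 2 + u * v + v ^ 2) * ((1 + (-1) ^ u) * (1 + (-1) ^ v)) := by
    simp only [gaussSumV, hN, sum_range_add, ← sum_add_distrib]
    exact sum_congr rfl fun u _ => sum_congr rfl fun v _ => dyadicChar_sum_translates k u v
  rw [key, hH, sum_range_two_mul, gaussSumV, mul_sum]
  refine sum_congr rfl fun i _ => ?_
  rw [sum_range_two_mul, sum_range_two_mul, ← sum_add_distrib, mul_sum]
  refine sum_congr rfl fun j _ => ?_
  rw [show (2 * i) ^ 2 + 2 * i * (2 * j) + (2 * j) ^ 2 = 4 * (i ^ 2 + i * j + j ^ 2) by ring,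
    dyadicChar_four_mul]
  simp only [pow_succ _ (2 * _), pow_mul, even_two.neg_one_pow, one_pow]
  ring

lemma gaussSumV_eq (k : ℕ) : gaussSumV k = (-2) ^ k := by
  induction k using Nat.twoStepInduction with
  | zero => simp [gaussSumV, dyadicChar]
  | one =>
    have hE (m : ℕ) : dyadicChar 1 m = (-1) ^ m := by
      simpa using dyadicChar_half_mul 0 m
    simp [gaussSumV, hE, sum_range_succ]
    norm_num
  | more k ih _ => rw [gaussSumV_add_two, ih]; ring

/-- The Gauss-sum form of `sign v_+^{(2)}(2^k) ≡ 4k (mod 8)`: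
the double Gauss sum of the form `v_+^{(2)}(2^k)` equals `(-1)^k · 2^k`. -/
theorem sign_v_two (k : ℕ) (hk : 1 ≤ k) :
    ∑ x ∈ Finset.range (2 ^ k), ∑ y ∈ Finset.range (2 ^ k),
        Complex.exp (2 * Real.pi * Complex.I *
          ((x : ℂ) ^ 2 + (x : ℂ) * (y : ℂ) + (y : ℂ) ^ 2) / (2 : ℂ) ^ k)
      = (-1 : ℂ) ^ k * (2 : ℂ) ^ k := by
  rw [← mul_pow, neg_one_mul, ← gaussSumV_eq]
  simp [gaussSumV, dyadicChar]
end

section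
/- Let A be an n×n symmetric integer matrix with all diagonal entries even and det A = 1 or det A = −1 (i.e., A is the Gram matrix of an even unimodular lattice). Then the signature of A is divisible by 8. -/
open Matrix

/-- The signature `t₊ - t₋` of a symmetric integer matrix, computed from the eigenvalues
(with multiplicity) of the associated real symmetric matrix. -/
noncomputable def matrixSignature {n : ℕ} (A : Matrix (Fin n) (Fin n) ℤ)
    (hHerm : (A.map ((↑) : ℤ → ℝ)).IsHermitian) : ℤ :=
  ((Finset.univ.filter fun i => 0 < hHerm.eigenvalues i).card : ℤ) -
    ((Finset.univ.filter fun i => hHerm.eigenvalues i < 0).card : ℤ)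

open Complex Filter Topology Real in
/-- Near the rational point `1 / (2e)`, the theta series splits over residue classes modulo `N`. -/
theorem jacobiTheta_eq_sum_evenKernel (e N : ℕ) (he : 0 < e) (hN : 0 < N) (h : 4 * e ∣ N)
    {ε : ℝ} (hε : 0 < ε) :
    jacobiTheta (1 / (2 * e : ℂ) + I * ε) = ∑ r : Fin N, cexp (2 * π * I * (r : ℂ) ^ 2 / (4 * e)) *
      (HurwitzZeta.evenKernel (((r : ℝ) / N : ℝ) : UnitAddCircle) (N ^ 2 * ε) : ℂ) := by
  have : NeZero N := ⟨hN.ne'⟩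
  obtain ⟨c, rfl⟩ := h
  have hc : 0 < c := Nat.pos_of_mul_pos_left hN 
  have heC : (e : ℂ) ≠ 0 := by exact_mod_cast he.ne'
  have hcC : (c : ℂ) ≠ 0 := by exact_mod_cast hc.ne'
  have hτ : 0 < (1 / (2 * e : ℂ) + I * ε).im := by
    have : (1 / (2 * e : ℂ)) = ((1 / (2 * e) : ℝ) : ℂ) := by push_cast; rfl
    rw [this]
    simpa using hε
  have hs : HasSum (fun n : ℤ => cexp (π * I * (n : ℂ) ^ 2 * (1 / (2 * e : ℂ) + I * ε)))
      (jacobiTheta (1 / (2 * e : ℂ) + I * ε)) := by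
    have := hasSum_jacobiTheta₂_term 0 hτ
    simpa [jacobiTheta₂_term, ← jacobiTheta_eq_jacobiTheta₂] using this
  rw [← (Int.divModEquiv (4 * e * c)).symm.hasSum_iff] at hs
  have hr (r : Fin (4 * e * c)) : HasSum (fun m : ℤ =>
      ((fun n : ℤ => cexp (π * I * (n : ℂ) ^ 2 * (1 / (2 * e : ℂ) + I * ε))) ∘
        (Int.divModEquiv (4 * e * c)).symm) (m, r))
      (cexp (2 * π * I * (r : ℂ) ^ 2 / (4 * e)) *
      (HurwitzZeta.evenKernel (((r : ℝ) / (4 * e * c : ℕ) : ℝ) : UnitAddCircle)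
        (((4 * e * c : ℕ) : ℝ) ^ 2 * ε) : ℂ)) := by
    have hx : 0 < ((4 * e * c : ℕ) : ℝ) ^ 2 * ε := by positivity
    have := HurwitzZeta.hasSum_int_evenKernel ((r : ℝ) / (4 * e * c : ℕ)) hx
    rw [← hasSum_ofReal] at this
    refine (this.mul_left (cexp (2 * π * I * (r : ℂ) ^ 2 / (4 * e)))).congr_fun fun m => ?_
    simp only [Function.comp_apply, Int.divModEquiv_symm_apply]
    push_cast
    rw [← Complex.exp_add, Complex.exp_eq_exp_iff_exists_int]
    refine ⟨4 * e * c ^ 2 * m ^ 2 + 2 * c * m * r, ?_⟩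
    push_cast
    field_simp
    ring_nf
    simp only [I_sq]
    ring
  have hs' := ((Equiv.prodComm _ _).hasSum_iff.mpr hs).prod_fiberwise (g := fun r => _) hr
  exact hs'.unique (hasSum_fintype _)

open Complex Filter Topology Real in
theorem tendsto_sqrt_mul_evenKernel (a : UnitAddCircle) (N : ℕ) (hN : 0 < N) :
    Tendsto (fun ε : ℝ => √ε * HurwitzZeta.evenKernel a (N ^ 2 * ε)) (𝓝[>] 0) (𝓝 (1 / N)) := by
  have h1 : Tendsto (HurwitzZeta.cosKernel a) atTop (𝓝 1) := by
    obtain ⟨p, hp, h⟩ := HurwitzZeta.isBigO_atTop_cosKernel_sub a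
    have h2 : Tendsto (fun x : ℝ => rexp (-p * x)) atTop (𝓝 0) := by
      refine Real.tendsto_exp_atBot.comp ?_
      exact tendsto_id.const_mul_atTop_of_neg (by linarith)
    have := (h.trans_tendsto h2).add_const 1
    simpa using this
  have h2 : Tendsto (fun ε : ℝ => 1 / ((N : ℝ) ^ 2 * ε)) (𝓝[>] 0) atTop := by
    simp only [one_div]
    refine tendsto_inv_nhdsGT_zero.comp ?_
    refine tendsto_nhdsWithin_iff.mpr ⟨?_, ?_⟩
    · have : Tendsto (fun ε : ℝ => (N : ℝ) ^ 2 * ε) (𝓝 0) (𝓝 ((N : ℝ) ^ 2 * 0)) :=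
        tendsto_id.const_mul _
      simpa using this.mono_left nhdsWithin_le_nhds
    · filter_upwards [self_mem_nhdsWithin] with ε hε
      have : (0 : ℝ) < ε := hε
      simp only [Set.mem_Ioi]; positivity
  have h3 := (h1.comp h2).const_mul (1 / (N : ℝ))
  rw [mul_one] at h3
  refine h3.congr' ?_
  filter_upwards [self_mem_nhdsWithin] with ε hε
  have hε : (0 : ℝ) < ε := hε
  rw [HurwitzZeta.evenKernel_functional_equation, ← Real.sqrt_eq_rpow, Real.sqrt_mul (by positivity),
    Real.sqrt_sq (by positivity)]
  have : 0 < √ε := by positivity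
  simp only [Function.comp]
  field_simp

open Complex Filter Topology Real in
/-- The radial asymptotics of theta at `1 / (2e)` are given by a quadratic Gauss sum. -/
theorem tendsto_sqrt_mul_jacobiTheta (e N : ℕ) (he : 0 < e) (hN : 0 < N) (h : 4 * e ∣ N) :
    Tendsto (fun ε : ℝ => (√ε : ℂ) * jacobiTheta (1 / (2 * e : ℂ) + I * ε)) (𝓝[>] 0)
      (𝓝 ((∑ r : Fin N, cexp (2 * π * I * (r : ℂ) ^ 2 / (4 * e))) * (1 / N : ℝ))) := by
  rw [Finset.sum_mul]
  have := tendsto_finsetSum Finset.univ fun (r : Fin N) _ =>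
    ((continuous_ofReal.tendsto _).comp
      (tendsto_sqrt_mul_evenKernel (((r : ℝ) / N : ℝ) : UnitAddCircle) N hN)).const_mul
        (cexp (2 * π * I * (r : ℂ) ^ 2 / (4 * e)))
  refine this.congr' ?_
  filter_upwards [self_mem_nhdsWithin] with ε hε
  rw [jacobiTheta_eq_sum_evenKernel e N he hN h hε, Finset.mul_sum]
  refine Finset.sum_congr rfl fun r _ => ?_
  simp only [Function.comp]
  push_cast
  ring

open Complex in
theorem cpow_ofReal_mul {r : ℝ} (hr : 0 < r) {x : ℂ} (hx : x ≠ 0) (s : ℂ) :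
    ((r : ℂ) * x) ^ s = (r : ℂ) ^ s * x ^ s := by
  have hr' : (r : ℂ) ≠ 0 := by exact_mod_cast hr.ne'
  rw [cpow_def_of_ne_zero (mul_ne_zero hr' hx), cpow_def_of_ne_zero hr', cpow_def_of_ne_zero hx,
    log_ofReal_mul hr hx, ofReal_log hr.le, add_mul, Complex.exp_add]

open Complex in
theorem cpow_half_ofReal {r : ℝ} (hr : 0 ≤ r) : (r : ℂ) ^ (1 / 2 : ℂ) = (√r : ℂ) := by
  rw [Real.sqrt_eq_rpow, ofReal_cpow hr]
  push_cast
  rfl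

open Complex Filter Topology Real in
/-- The radial asymptotics of theta at `1 / (2e)`, computed from its functional equation. -/
theorem tendsto_sqrt_mul_jacobiTheta_transform (e : ℕ) (he : 0 < e) :
    Tendsto (fun ε : ℝ => (√ε : ℂ) * jacobiTheta (1 / (2 * e : ℂ) + I * ε)) (𝓝[>] 0)
      (𝓝 ((1 / (2 * e * √(1 / (2 * e))) : ℝ) * cexp (π * I / 4))) := by
  have heC : (e : ℂ) ≠ 0 := by exact_mod_cast he.ne'
  have heR : (0 : ℝ) < e := by exact_mod_cast he
  set τ : ℝ → ℂ := fun ε => 1 / (2 * e : ℂ) + I * ε with hτdef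
  have hτre (ε : ℝ) : (τ ε).re = 1 / (2 * e) := by
    have : (1 / (2 * e : ℂ)) = ((1 / (2 * e) : ℝ) : ℂ) := by push_cast; rfl
    simp only [hτdef]
    rw [this]
    simp
  have hτ0 (ε : ℝ) : τ ε ≠ 0 := by
    intro h0
    have := hτre ε
    rw [h0, zero_re] at this
    have : (0 : ℝ) < 1 / (2 * e) := by positivity
    linarith
  have hτcont : Tendsto τ (𝓝[>] 0) (𝓝 (1 / (2 * e : ℂ))) := by
    have : Continuous τ := by fun_prop
    simpa [hτdef] using (this.tendsto 0).mono_left nhdsWithin_le_nhds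
  have hperiod (m : ℕ) (z : ℂ) : jacobiTheta (z - 2 * m) = jacobiTheta z := by
    induction m with
    | zero => simp
    | succ k ih =>
      rw [← ih, ← jacobiTheta_two_add]
      congr 1
      push_cast
      ring
  have hfe (z : ℂ) : jacobiTheta z = 1 / (-I * z) ^ (1 / 2 : ℂ) * jacobiTheta (-1 / z) := by
    simp only [jacobiTheta_eq_jacobiTheta₂]
    rw [jacobiTheta₂_functional_equation]
    simp
  have key (ε : ℝ) (hε : 0 < ε) : (√ε : ℂ) * jacobiTheta (τ ε) =
      1 / (-I * τ ε) ^ (1 / 2 : ℂ) * (1 / (2 * e / τ ε) ^ (1 / 2 : ℂ)) *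
        jacobiTheta (I * τ ε / (2 * e * ε)) := by
    have hεC : (ε : ℂ) ≠ 0 := by exact_mod_cast hε.ne'
    have h1 : -1 / τ ε = 2 * e * I * ε / τ ε - 2 * e := by
      have := hτ0 ε
      field_simp
      simp only [hτdef]
      field_simp
      ring
    have h2 : -1 / (2 * e * I * ε / τ ε) = I * τ ε / (2 * e * ε) := by
      have := hτ0 ε
      field_simp
      simp
    have h3 : -I * (2 * e * I * ε / τ ε) = (ε : ℂ) * (2 * e / τ ε) := by
      have := hτ0 ε
      field_simp
      simp
    rw [hfe, h1, hperiod, hfe (2 * e * I * ε / τ ε), h2, h3, cpow_ofReal_mul hε, cpow_half_ofReal hε.le]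
    · have : (√ε : ℂ) ≠ 0 := by
        have : √ε ≠ 0 := by positivity
        exact_mod_cast this
      field_simp
    · exact div_ne_zero (mul_ne_zero two_ne_zero heC) (hτ0 ε)
  have hlim1 : Tendsto (fun ε : ℝ => jacobiTheta (I * τ ε / (2 * e * ε))) (𝓝[>] 0) (𝓝 1) := by
    have him : Tendsto (fun ε : ℝ => I * τ ε / (2 * e * ε)) (𝓝[>] 0) (comap im atTop) := by
      rw [tendsto_comap_iff]
      have : im ∘ (fun ε : ℝ => I * τ ε / (2 * e * ε)) = fun ε : ℝ => 1 / (2 * e) ^ 2 * ε⁻¹ := by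
        funext ε
        have h1 : I * τ ε / (2 * e * ε) = I * τ ε / ((2 * e * ε : ℝ) : ℂ) := by push_cast; rfl
        simp only [Function.comp]
        rw [h1, div_ofReal_im, I_mul_im, hτre]
        by_cases hε : ε = 0
        · simp [hε]
        · field_simp
      rw [this]
      exact tendsto_inv_nhdsGT_zero.const_mul_atTop (by positivity)
    have hexp : Tendsto (fun z : ℂ => rexp (-π * z.im)) (comap im atTop) (𝓝 0) := by
      refine Real.tendsto_exp_atBot.comp ?_
      exact (tendsto_comap).const_mul_atTop_of_neg (by linarith [Real.pi_pos])
    have := (isBigO_at_im_infty_jacobiTheta_sub_one.trans_tendsto hexp).add_const 1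
    simpa [Function.comp_def] using this.comp him
  have hlim2 : Tendsto (fun ε : ℝ => (-I * τ ε) ^ (1 / 2 : ℂ)) (𝓝[>] 0)
      (𝓝 ((-I * (1 / (2 * e : ℂ))) ^ (1 / 2 : ℂ))) := by
    refine (hτcont.const_mul (-I)).cpow tendsto_const_nhds ?_
    right
    simp [he.ne']
  have hlim3 : Tendsto (fun ε : ℝ => (2 * e / τ ε) ^ (1 / 2 : ℂ)) (𝓝[>] 0)
      (𝓝 ((2 * e / (1 / (2 * e : ℂ))) ^ (1 / 2 : ℂ))) := by
    refine ((tendsto_const_nhds (x := (2 * e : ℂ))).div hτcont (by simp [he.ne'])).cpow tendsto_const_nhds ?_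
    left
    have : (2 * e / (1 / (2 * e : ℂ))) = ((2 * e * (2 * e) : ℝ) : ℂ) := by
      push_cast; field_simp
    rw [this, ofReal_re]
    positivity
  have e2 : (-I * (1 / (2 * e : ℂ))) ^ (1 / 2 : ℂ) = √(1 / (2 * e)) * cexp (-(π * I / 4)) := by
    have : (-I * (1 / (2 * e : ℂ))) = ((1 / (2 * e) : ℝ) : ℂ) * (-I) := by push_cast; ring
    rw [this, cpow_ofReal_mul (by positivity) (by simp), cpow_half_ofReal (by positivity),
      cpow_def_of_ne_zero (by simp), log_neg_I]
    congr 2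
    ring
  have e3 : (2 * e / (1 / (2 * e : ℂ))) ^ (1 / 2 : ℂ) = ((2 * e : ℝ) : ℂ) := by
    have : (2 * e / (1 / (2 * e : ℂ))) = (((2 * e) ^ 2 : ℝ) : ℂ) := by
      push_cast; field_simp
    rw [this, cpow_half_ofReal (by positivity), Real.sqrt_sq (by positivity)]
  rw [e2] at hlim2
  rw [e3] at hlim3
  have hs : (√(1 / (2 * e)) : ℂ) ≠ 0 := by
    have : √(1 / (2 * e : ℝ)) ≠ 0 := by positivity
    exact_mod_cast this
  have hfin := (((tendsto_const_nhds (x := (1 : ℂ))).div hlim2 (mul_ne_zero hs (Complex.exp_ne_zero _))).mul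
    ((tendsto_const_nhds (x := (1 : ℂ))).div hlim3 (by simp [he.ne']))).mul hlim1
  have hval : 1 / (√(1 / (2 * e)) * cexp (-(π * I / 4))) * (1 / ((2 * e : ℝ) : ℂ)) * 1 =
      (1 / (2 * e * √(1 / (2 * e))) : ℝ) * cexp (π * I / 4) := by
    rw [Complex.exp_neg]
    push_cast
    have := Complex.exp_ne_zero (π * I / 4)
    field_simp
  rw [hval] at hfin
  refine hfin.congr' ?_
  filter_upwards [self_mem_nhdsWithin] with ε hε
  exact (key ε hε).symm

open Complex Real in
/-- The quadratic Gauss sum of modulus divisible by four has argument `π / 4`. -/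
theorem exists_gaussSum_eq (e N : ℕ) (he : 0 < e) (hN : 0 < N) (h : 4 * e ∣ N) :
    ∃ R : ℝ, 0 < R ∧
      ∑ r : Fin N, cexp (2 * π * I * (r : ℂ) ^ 2 / (4 * e)) = R * cexp (π * I / 4) := by
  have := tendsto_nhds_unique (tendsto_sqrt_mul_jacobiTheta e N he hN h)
    (tendsto_sqrt_mul_jacobiTheta_transform e he)
  have hN' : (N : ℂ) ≠ 0 := by exact_mod_cast hN.ne'
  refine ⟨N * (1 / (2 * e * √(1 / (2 * e)))), by positivity, ?_⟩
  rw [ofReal_mul, mul_assoc (_ : ℂ) (_ : ℂ) (cexp (π * I / 4)), ← this]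
  push_cast
  rw [mul_comm (N : ℂ), one_div, inv_mul_cancel_right₀ hN']

open Complex Real in
/-- The argument of a quadratic Gauss sum over `ZMod N`, in terms of the sign of its coefficient. -/
theorem exists_sum_stdAddChar_eq (N : ℕ) [NeZero N] (e c : ℤ) (hN : 4 * e * c = N) :
    ∃ R : ℝ, 0 < R ∧
      ∑ k : ZMod N, ZMod.stdAddChar ((c : ZMod N) * (k * k)) = R * cexp (e.sign * (π * I / 4)) := by
  have hN0 : (N : ℤ) ≠ 0 := by exact_mod_cast NeZero.ne N
  have hpos : ∀ e c : ℕ, 4 * e * c = N → ∃ R : ℝ, 0 < R ∧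
      ∑ k : ZMod N, ZMod.stdAddChar ((c : ZMod N) * (k * k)) = R * cexp (π * I / 4) := by
    intro e c h
    have he : 0 < e := by
      rcases Nat.eq_zero_or_pos e with rfl | h'
      · simp at h; exact absurd h.symm (NeZero.ne N)
      · exact h'
    obtain ⟨R, hR, hs⟩ := exists_gaussSum_eq e N he (Nat.pos_of_ne_zero (NeZero.ne N)) ⟨c, h.symm⟩
    refine ⟨R, hR, ?_⟩
    have hbij : Function.Bijective fun r : Fin N => ((r : ℕ) : ZMod N) := by
      refine (Fintype.bijective_iff_injective_and_card _).2 ⟨fun a b hab => ?_, by simp⟩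
      have := (ZMod.natCast_eq_natCast_iff' _ _ _).1 hab
      rw [Nat.mod_eq_of_lt a.2, Nat.mod_eq_of_lt b.2] at this
      exact Fin.ext this
    rw [← hs, ← hbij.sum_comp]
    refine Finset.sum_congr rfl fun r _ => ?_
    have := ZMod.stdAddChar_coe (N := N) (c * (r * r) : ℤ)
    push_cast at this
    rw [this]
    congr 1
    have hNC : (N : ℂ) = 4 * e * c := by exact_mod_cast h.symm
    rw [hNC]
    have heC : (e : ℂ) ≠ 0 := by exact_mod_cast he.ne'
    have hcC : (c : ℂ) ≠ 0 := by
      rintro h0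
      have : c = 0 := by exact_mod_cast h0
      subst this
      simp at h; exact absurd h.symm (NeZero.ne N)
    field_simp
  rcases lt_trichotomy e 0 with he | rfl | he
  · have hc : c < 0 := by
      by_contra hc
      have : (0 : ℤ) < N := by positivity
      nlinarith
    obtain ⟨a, rfl⟩ : ∃ a : ℕ, e = -a := ⟨e.natAbs, by omega⟩
    obtain ⟨b, rfl⟩ : ∃ b : ℕ, c = -b := ⟨c.natAbs, by omega⟩
    obtain ⟨R, hR, hs⟩ := hpos a b (by zify; rw [← hN]; ring)
    refine ⟨R, hR, ?_⟩
    have := congrArg (starRingEnd ℂ) hs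
    rw [map_sum, map_mul, conj_ofReal, ← Complex.exp_conj] at this
    rw [Int.sign_eq_neg_one_of_neg he]
    convert this using 2
    · rename_i k
      rw [← AddChar.map_neg_eq_conj]
      push_cast
      ring_nf
    · congr 1
      rw [map_div₀, map_mul, conj_ofReal, conj_I, Complex.conj_ofNat]
      push_cast
      ring
  · exact absurd (by simpa using hN.symm) hN0
  · have hc : 0 < c := by
      by_contra hc
      have : (0 : ℤ) < N := by positivity
      nlinarith
    obtain ⟨a, rfl⟩ : ∃ a : ℕ, e = a := ⟨e.natAbs, by omega⟩
    obtain ⟨b, rfl⟩ : ∃ b : ℕ, c = b := ⟨c.natAbs, by omega⟩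
    rw [Int.sign_eq_one_of_pos he]
    simpa using hpos a b (by exact_mod_cast hN)

/-- A symmetric integer matrix with even diagonal takes even values as a quadratic form. -/
theorem even_dotProduct_mulVec {ι : Type*} [Fintype ι] [LinearOrder ι] {A : Matrix ι ι ℤ}
    (hA : A.IsSymm) (hE : ∀ i, Even (A i i)) (x : ι → ℤ) : Even (x ⬝ᵥ A *ᵥ x) := by
  let U : Matrix ι ι ℤ := of fun i j => if i < j then A i j else if i = j then A i i / 2 else 0
  have hU : A = U + Uᵀ := by
    ext i j
    simp only [U, Matrix.add_apply, transpose_apply, of_apply]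
    rcases lt_trichotomy i j with h | rfl | h
    · simp [h, h.not_gt, h.ne']
    · have := hE i
      simp
      grind
    · simp [h, h.not_gt, h.ne', hA.apply i j]
  refine ⟨x ⬝ᵥ U *ᵥ x, ?_⟩
  conv_lhs => rw [hU]
  rw [add_mulVec, dotProduct_add]
  congr 1
  rw [mulVec_transpose, dotProduct_comm, dotProduct_mulVec]

/-- A symmetric integer matrix becomes diagonal after an integral change of basis over `ℚ`. -/
theorem exists_int_diagonalization {ι : Type*} [Fintype ι] [DecidableEq ι] {A : Matrix ι ι ℤ}
    (hA : A.IsSymm) :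
    ∃ (P : Matrix ι ι ℤ) (d : ι → ℤ), P.det ≠ 0 ∧ Pᵀ * A * P = diagonal d := by
  let A' : Matrix ι ι ℚ := A.map (Int.castRingHom ℚ)
  have hA' : A'.IsSymm := by
    have := congrArg (fun M => M.map (Int.castRingHom ℚ)) hA
    rw [IsSymm]
    ext i j
    exact congrFun (congrFun this i) j
  have hB : LinearMap.IsSymm (toBilin' A') := by
    refine ⟨fun x y => ?_⟩
    simp only [toBilin'_apply', RingHom.id_apply]
    rw [dotProduct_mulVec, ← mulVec_transpose, hA'.eq, dotProduct_comm]
  obtain ⟨v, hv⟩ := LinearMap.BilinForm.exists_orthogonal_basis hB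
  let e : Fin (Module.finrank ℚ (ι → ℚ)) ≃ ι :=
    Fintype.equivOfCardEq (by simp)
  let w := v.reindex e
  have hw : ∀ i j, i ≠ j → w i ⬝ᵥ A' *ᵥ w j = 0 := by
    intro i j hij
    have := hv (e.symm.injective.ne hij)
    simpa [w, toBilin'_apply', Function.onFun] using this
  obtain ⟨b, hb⟩ := IsLocalization.exist_integer_multiples_of_finite (nonZeroDivisors ℤ)
    (fun p : ι × ι => w p.2 p.1)
  choose f hf using hb
  have hb0 : ((b : ℤ) : ℚ) ≠ 0 := by
    exact_mod_cast nonZeroDivisors.ne_zero b.2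
  let P : Matrix ι ι ℤ := of fun i j => f (i, j)
  have hP : P.map (Int.castRingHom ℚ) = ((b : ℤ) : ℚ) • (Pi.basisFun ℚ ι).toMatrix w := by
    ext i j
    have := hf (i, j)
    simpa [P, Module.Basis.toMatrix_apply, Algebra.smul_def] using this
  refine ⟨P, fun i => (Pᵀ * A * P) i i, ?_, ?_⟩
  · intro h0
    have h1 : (P.map (Int.castRingHom ℚ)).det = 0 := by
      rw [← RingHom.mapMatrix_apply, ← RingHom.map_det, h0, map_zero]
    rw [hP, det_smul] at h1
    have h2 := (Pi.basisFun ℚ ι).isUnit_det w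
    rw [Module.Basis.det_apply] at h2
    exact mul_ne_zero (pow_ne_zero _ hb0) h2.ne_zero h1
  · ext i j
    by_cases hij : i = j
    · subst hij; simp
    · rw [diagonal_apply_ne _ hij]
      have h1 : ((Pᵀ * A * P).map (Int.castRingHom ℚ)) i j = 0 := by
        rw [Matrix.map_mul, Matrix.map_mul, transpose_map, hP]
        have := hw i j hij
        simp only [transpose_smul, Matrix.smul_mul, Matrix.mul_smul, Matrix.smul_apply]
        have h3 : (((Pi.basisFun ℚ ι).toMatrix w)ᵀ * A.map (Int.castRingHom ℚ) *
            (Pi.basisFun ℚ ι).toMatrix w) i j = w i ⬝ᵥ A' *ᵥ w j := by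
          rw [Matrix.mul_assoc]
          rfl
        rw [h3, this]
        simp
      simpa using h1

/-- **Sylvester's law of inertia**, for the eigenvalues of a real symmetric matrix. -/
theorem card_eigenvalues_of_congr_diagonal {n : ℕ} {M P : Matrix (Fin n) (Fin n) ℝ}
    (hM : M.IsHermitian) (hP : P.det ≠ 0) {w : Fin n → ℝ} (h : Pᵀ * M * P = diagonal w) :
    (Finset.univ.filter fun i => 0 < hM.eigenvalues i).card =
      (Finset.univ.filter fun i => 0 < w i).card ∧
    (Finset.univ.filter fun i => hM.eigenvalues i < 0).card =
      (Finset.univ.filter fun i => w i < 0).card := by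
  have key : ∀ (Q : Matrix (Fin n) (Fin n) ℝ) (u : Fin n → ℝ), Q.det ≠ 0 →
      Qᵀ * M * Q = diagonal u → QuadraticMap.Equivalent M.toQuadraticForm'
        (QuadraticMap.weightedSumSquares ℝ u) := by
    intro Q u hQ hu
    refine QuadraticMap.Equivalent.symm ⟨⟨Matrix.toLinearEquiv' Q (Q.invertibleOfIsUnitDet hQ.isUnit), fun x => ?_⟩⟩
    have : (diagonal u *ᵥ x) ⬝ᵥ x = (Q *ᵥ x) ⬝ᵥ (M *ᵥ (Q *ᵥ x)) := by
      rw [← hu, ← mulVec_mulVec, ← mulVec_mulVec, mulVec_transpose, ← dotProduct_mulVec,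
        dotProduct_comm]
    rw [mulVec_mulVec] at this
    simp only [dotProduct, mulVec_diagonal] at this
    simpa [QuadraticMap.weightedSumSquares_apply, Matrix.toQuadraticForm', mul_assoc,
      toLinearMap₂'_apply', dotProduct] using this.symm
  have h1 := key P w hP h
  have h2 := key hM.eigenvectorUnitary hM.eigenvalues ?_ ?_
  · have hp := QuadraticForm.sigPos_of_equiv_weightedSumSquares h1
    have hn := QuadraticForm.sigNeg_of_equiv_weightedSumSquares h1
    rw [QuadraticForm.sigPos_of_equiv_weightedSumSquares h2] at hp
    rw [QuadraticForm.sigNeg_of_equiv_weightedSumSquares h2] at hn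
    simp only [Set.ncard_eq_toFinset_card', Set.toFinset_ofPred] at hp hn
    exact ⟨hp, hn⟩
  · exact (Matrix.UnitaryGroup.det_isUnit _).ne_zero
  · have := hM.conjStarAlgAut_star_eigenvectorUnitary
    rw [Unitary.conjStarAlgAut_star_apply] at this
    simpa [star_eq_conjTranspose, conjTranspose_eq_transpose_of_trivial] using this

theorem AddChar.map_finset_sum_eq_prod {G R ι : Type*} [AddCommMonoid G] [CommMonoid R]
    (ψ : AddChar G R) (s : Finset ι) (f : ι → G) : ψ (∑ i ∈ s, f i) = ∏ i ∈ s, ψ (f i) := by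
  classical
  induction s using Finset.induction_on with
  | empty => simp
  | insert a s ha ih => rw [Finset.sum_insert ha, Finset.prod_insert ha, map_add_eq_mul, ih]

theorem sum_stdAddChar_dotProduct {N : ℕ} [NeZero N] {ι : Type*} [Fintype ι] [DecidableEq ι]
    (z : ι → ZMod N) :
    ∑ m : ι → ZMod N, ZMod.stdAddChar (m ⬝ᵥ z) =
      if z = 0 then (N : ℂ) ^ Fintype.card ι else 0 := by
  have h1 : ∀ m : ι → ZMod N, ZMod.stdAddChar (m ⬝ᵥ z) =
      ∏ i, (ZMod.stdAddChar (m i * z i) : ℂ) := by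
    intro m
    rw [dotProduct, AddChar.map_finset_sum_eq_prod]
  simp only [h1]
  rw [← Fintype.prod_sum (fun i (k : ZMod N) => (ZMod.stdAddChar (k * z i) : ℂ))]
  simp only [AddChar.sum_mulShift _ (ZMod.isPrimitive_stdAddChar N), ZMod.card]
  split_ifs with h
  · simp [h]
  · obtain ⟨i, hi⟩ := Function.ne_iff.mp h
    exact Finset.prod_eq_zero (Finset.mem_univ i) (by rw [if_neg (by simpa using hi), Nat.cast_zero])

/-- The Gauss sum of a diagonal form that is rationally equivalent to an even unimodular form is a
positive integer. -/
theorem exists_gaussSum_pos {N : ℕ} [NeZero N] {ι : Type*} [Fintype ι] [DecidableEq ι]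
    {A B P : Matrix ι ι ℤ} {c d : ι → ℤ} (hAB : A * B = 1)
    (hB : ∀ x, Even (x ⬝ᵥ B *ᵥ x))
    (hP : P.det ≠ 0) (hd : Pᵀ * A * P = diagonal d) (hc : ∀ i, 2 * c i * d i = N) :
    ∃ k : ℕ, 0 < k ∧
      ∏ i, ∑ y : ZMod N, (ZMod.stdAddChar ((c i : ZMod N) * (y * y)) : ℂ) = k := by
  classical
  have hN : (N : ℤ) ≠ 0 := by exact_mod_cast NeZero.ne N
  have hdiag : (2 : ℤ) • diagonal c * diagonal d = (N : ℤ) • (1 : Matrix ι ι ℤ) := by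
    rw [smul_mul, diagonal_mul_diagonal, ← diagonal_smul, ← diagonal_one, ← diagonal_smul]
    congr 1
    funext i
    simp [← hc i, mul_assoc]
  have hX : ((2 : ℤ) • diagonal c * Pᵀ * A) * P = (N : ℤ) • (1 : Matrix ι ι ℤ) := by
    rw [← hdiag, ← hd]
    simp only [Matrix.mul_assoc]
  have hY : P * ((2 : ℤ) • diagonal c * Pᵀ * A) = (N : ℤ) • (1 : Matrix ι ι ℤ) := by
    have h1 : P * ((2 : ℤ) • diagonal c * Pᵀ * A) * P * P.adjugate =
        (N : ℤ) • (1 : Matrix ι ι ℤ) * P * P.adjugate := by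
      rw [Matrix.mul_assoc P, hX]
      simp only [Matrix.mul_smul, Matrix.smul_mul, Matrix.mul_one, Matrix.one_mul]
    rw [Matrix.mul_assoc _ P, Matrix.mul_assoc _ P, mul_adjugate, Matrix.mul_smul,
      Matrix.mul_smul] at h1
    simpa using smul_right_injective _ hP h1
  have hZ : (2 : ℤ) • (P * diagonal c * Pᵀ) = (N : ℤ) • B := by
    have := congrArg (· * B) hY
    simpa only [Matrix.mul_assoc, hAB, Matrix.smul_mul, Matrix.mul_smul, Matrix.one_mul,
      Matrix.mul_one] using this
  have hW : Pᵀ * A * ((2 : ℤ) • (P * diagonal c)) = (N : ℤ) • (1 : Matrix ι ι ℤ) := by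
    rw [← hdiag, Matrix.mul_smul, ← Matrix.mul_assoc, hd, smul_mul, diagonal_mul_diagonal,
      diagonal_mul_diagonal]
    congr 2
    funext i
    ring
  let ψ : AddChar (ZMod N) ℂ := ZMod.stdAddChar
  let P' : Matrix ι ι (ZMod N) := P.map (Int.castRingHom (ZMod N))
  let q : (ι → ZMod N) → ZMod N := fun y => ∑ i, (c i : ZMod N) * (y i * y i)
  let z : (ι → ZMod N) → (ι → ZMod N) := fun y => P' *ᵥ fun i => 2 * c i * y i
  have hlift : ∀ y : ι → ZMod N, ∃ x : ι → ℤ, (fun i => (x i : ZMod N)) = y := by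
    intro y
    choose x hx using fun i => ZMod.intCast_surjective (y i)
    exact ⟨x, funext hx⟩
  have hcastmul : ∀ (M : Matrix ι ι ℤ) (x : ι → ℤ),
      M.map (Int.castRingHom (ZMod N)) *ᵥ (fun i => (x i : ZMod N)) =
        fun i => (((M *ᵥ x) i : ℤ) : ZMod N) := by
    intro M x
    funext i
    simp [mulVec, dotProduct]
  have hqP : ∀ m, q (P'ᵀ *ᵥ m) = 0 := by
    intro m
    obtain ⟨x, rfl⟩ := hlift m
    have h1 : P'ᵀ = Pᵀ.map (Int.castRingHom (ZMod N)) := rfl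
    rw [h1, hcastmul]
    have h2 : (q fun i => (((Pᵀ *ᵥ x) i : ℤ) : ZMod N)) =
        ((∑ i, c i * ((Pᵀ *ᵥ x) i * (Pᵀ *ᵥ x) i) : ℤ) : ZMod N) := by
      simp [q]
    have h3 : (∑ i, c i * ((Pᵀ *ᵥ x) i * (Pᵀ *ᵥ x) i) : ℤ) =
        x ⬝ᵥ (P * diagonal c * Pᵀ) *ᵥ x := by
      rw [← mulVec_mulVec, ← mulVec_mulVec, dotProduct_mulVec, ← mulVec_transpose]
      simp only [dotProduct, mulVec_diagonal]
      exact Finset.sum_congr rfl fun i _ => by ring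
    obtain ⟨k, hk⟩ := hB x
    have h4 : 2 * (x ⬝ᵥ (P * diagonal c * Pᵀ) *ᵥ x) = N * (x ⬝ᵥ B *ᵥ x) := by
      have := congrArg (fun M => x ⬝ᵥ M *ᵥ x) hZ
      simpa only [smul_mulVec, dotProduct_smul, smul_eq_mul] using this
    have h5 : x ⬝ᵥ (P * diagonal c * Pᵀ) *ᵥ x = N * k := by
      rw [hk] at h4; linarith
    rw [h2, h3, h5]
    simp
  have hq_add : ∀ y m, q (y + P'ᵀ *ᵥ m) = q y + m ⬝ᵥ z y := by
    intro y m
    have h1 : m ⬝ᵥ z y = ∑ i, (P'ᵀ *ᵥ m) i * (2 * c i * y i) := by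
      simp only [z]
      rw [dotProduct_mulVec, ← mulVec_transpose]
      rfl
    have h2 := hqP m
    rw [h1, ← add_zero (q y + _), ← h2]
    simp only [q, ← Finset.sum_add_distrib, Pi.add_apply]
    exact Finset.sum_congr rfl fun i _ => by ring
  have hz : ∀ y, z y = 0 → q y = 0 := by
    intro y hy
    obtain ⟨x, rfl⟩ := hlift y
    have h1 : (z fun i => (x i : ZMod N)) =
        fun i => (((((2 : ℤ) • (P * diagonal c)) *ᵥ x) i : ℤ) : ZMod N) := by
      rw [← hcastmul]
      simp only [z]
      have : (fun i => 2 * (c i : ZMod N) * (x i : ZMod N)) =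
          ((2 : ℤ) • diagonal c).map (Int.castRingHom (ZMod N)) *ᵥ (fun i => (x i : ZMod N)) := by
        rw [hcastmul, smul_mulVec]
        funext i
        simp [mulVec_diagonal, mul_assoc]
      rw [this, mulVec_mulVec, ← Matrix.map_mul, Matrix.mul_smul]
    rw [h1] at hy
    have h2 : ∀ i, ∃ k, (((2 : ℤ) • (P * diagonal c)) *ᵥ x) i = N * k := fun i =>
      (ZMod.intCast_zmod_eq_zero_iff_dvd _ N).1 (congrFun hy i)
    choose m hm using h2
    have h3 : (((2 : ℤ) • (P * diagonal c)) *ᵥ x) = (N : ℤ) • m := funext hm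
    have h4 : (Pᵀ * A) *ᵥ m = x := by
      have := congrArg (fun v => (Pᵀ * A) *ᵥ v) h3
      simp only [mulVec_mulVec, hW] at this
      rw [mulVec_smul, smul_mulVec, one_mulVec] at this
      exact (smul_right_injective _ hN this).symm
    rw [← mulVec_mulVec] at h4
    have h5 := hcastmul Pᵀ (A *ᵥ m)
    rw [h4] at h5
    rw [← h5]
    exact hqP _
  have hprod : ∏ i, ∑ y : ZMod N, (ZMod.stdAddChar ((c i : ZMod N) * (y * y)) : ℂ) =
      ∑ y, ψ (q y) := by
    rw [Fintype.prod_sum (fun i (y : ZMod N) => (ZMod.stdAddChar ((c i : ZMod N) * (y * y)) : ℂ))]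
    exact Finset.sum_congr rfl fun y _ => (AddChar.map_finset_sum_eq_prod _ _ _).symm
  refine ⟨(Finset.univ.filter fun y => z y = 0).card, ?_, ?_⟩
  · refine Finset.card_pos.mpr ⟨0, ?_⟩
    simp only [Finset.mem_filter_univ, z]
    funext i
    simp [mulVec, dotProduct]
  · have h1 : ∑ m : ι → ZMod N, ∑ y, ψ (q (y + P'ᵀ *ᵥ m)) =
        (N : ℂ) ^ Fintype.card ι * ∑ y, ψ (q y) := by
      have : ∀ m, ∑ y, ψ (q (y + P'ᵀ *ᵥ m)) = ∑ y, ψ (q y) := fun m =>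
        Equiv.sum_comp (Equiv.addRight (P'ᵀ *ᵥ m)) (fun y => ψ (q y))
      simp [this]
    have h2 : ∑ m : ι → ZMod N, ∑ y, ψ (q (y + P'ᵀ *ᵥ m)) =
        (N : ℂ) ^ Fintype.card ι * (Finset.univ.filter fun y => z y = 0).card := by
      rw [Finset.sum_comm]
      simp only [hq_add, AddChar.map_add_eq_mul, ← Finset.mul_sum]
      have : ∀ y, ψ (q y) * ∑ m : ι → ZMod N, ψ (m ⬝ᵥ z y) =
          if z y = 0 then (N : ℂ) ^ Fintype.card ι else 0 := by
        intro y
        rw [sum_stdAddChar_dotProduct]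
        split_ifs with h
        · simp [hz y h]
        · simp
      simp only [this]
      rw [← Finset.sum_filter, Finset.sum_const, nsmul_eq_mul, mul_comm]
    rw [hprod]
    have hNC : (N : ℂ) ^ Fintype.card ι ≠ 0 := pow_ne_zero _ (by exact_mod_cast NeZero.ne N)
    exact mul_left_cancel₀ hNC (h1.symm.trans h2)

/-- The signature of an even unimodular lattice is divisible by 8. -/
theorem even_unimodular_sign_div_eight (n : ℕ) (A : Matrix (Fin n) (Fin n) ℤ)
    (hSymm : A.IsSymm) (hEven : ∀ i, Even (A i i)) (hdet : A.det = 1 ∨ A.det = -1)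
    (hHerm : (A.map ((↑) : ℤ → ℝ)).IsHermitian) :
    (8 : ℤ) ∣ matrixSignature A hHerm := by
  have hBs : ∃ B : Matrix (Fin n) (Fin n) ℤ, A * B = 1 := by
    have hu : IsUnit A.det := by rcases hdet with h | h <;> simp [h]
    exact ⟨A⁻¹, mul_nonsing_inv A hu⟩
  obtain ⟨B, hAB⟩ := hBs
  have hBA : B * A = 1 := mul_eq_one_comm.mp hAB
  have hB : ∀ x, Even (x ⬝ᵥ B *ᵥ x) := by
    intro x
    have h := even_dotProduct_mulVec hSymm hEven (B *ᵥ x)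
    rwa [mulVec_mulVec, hAB, one_mulVec, dotProduct_comm] at h
  obtain ⟨P, d, hP, hd⟩ := exists_int_diagonalization hSymm
  have hdEven : ∀ i, Even (d i) := by
    intro i
    have h1 := even_dotProduct_mulVec hSymm hEven (P *ᵥ Pi.single i 1)
    have h2 : (P *ᵥ Pi.single i 1) ⬝ᵥ A *ᵥ (P *ᵥ Pi.single i 1) = (Pᵀ * A * P) i i := by
      rw [mulVec_single_one, Matrix.mul_assoc]
      rfl
    rwa [h2, hd, diagonal_apply_eq] at h1
  choose e he using hdEven
  have hd0 : ∀ i, d i ≠ 0 := by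
    have h1 := congrArg det hd
    rw [det_mul, det_mul, det_transpose, det_diagonal] at h1
    have hA0 : A.det ≠ 0 := by rcases hdet with h | h <;> simp [h]
    have h2 : ∏ i, d i ≠ 0 := h1 ▸ mul_ne_zero (mul_ne_zero hP hA0) hP
    exact fun i => Finset.prod_ne_zero_iff.1 h2 i (Finset.mem_univ i)
  have he0 : ∀ i, e i ≠ 0 := fun i h0 => hd0 i (by rw [he, h0, add_zero])
  let N : ℕ := 4 * ∏ i, (e i).natAbs
  have : NeZero N := ⟨mul_ne_zero four_ne_zero
    (Finset.prod_ne_zero_iff.2 fun i _ => Int.natAbs_ne_zero.2 (he0 i))⟩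
  have hdvd : ∀ i, e i ∣ ((∏ j, (e j).natAbs : ℕ) : ℤ) := fun i =>
    Int.dvd_natCast.2 (Finset.dvd_prod_of_mem _ (Finset.mem_univ i))
  choose c hc using hdvd
  have hN : ∀ i, 4 * e i * c i = N := by
    intro i
    rw [mul_assoc, ← hc]
    simp [N]
  obtain ⟨k, hk, hprod⟩ := exists_gaussSum_pos (N := N) (c := c) hAB hB hP hd
    (fun i => by rw [← hN i, he]; ring)
  choose R hR hsum using fun i => exists_sum_stdAddChar_eq N (e i) (c i) (hN i)
  have hsig : matrixSignature A hHerm = ∑ i, (e i).sign := by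
    have hcong : (P.map ((↑) : ℤ → ℝ))ᵀ * A.map ((↑) : ℤ → ℝ) * P.map ((↑) : ℤ → ℝ) =
        diagonal fun i => (d i : ℝ) := by
      have h := congrArg (fun M => M.map (Int.castRingHom ℝ)) hd
      simp only [Matrix.map_mul, diagonal_map (map_zero (Int.castRingHom ℝ))] at h
      exact h
    have hP' : (P.map ((↑) : ℤ → ℝ)).det ≠ 0 := by
      have h : ((P.det : ℤ) : ℝ) = (P.map ((↑) : ℤ → ℝ)).det := (Int.castRingHom ℝ).map_det P
      rw [← h]
      exact_mod_cast hP
    obtain ⟨h1, h2⟩ := card_eigenvalues_of_congr_diagonal hHerm hP' hcong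
    rw [matrixSignature, h1, h2, Finset.card_filter, Finset.card_filter]
    push_cast
    rw [← Finset.sum_sub_distrib]
    refine Finset.sum_congr rfl fun i _ => ?_
    have := he i
    rcases lt_trichotomy (e i) 0 with h | h | h
    · have h' : d i < 0 := by omega
      simp [Int.sign_eq_neg_one_of_neg h, h', h'.not_gt]
    · exact absurd h (he0 i)
    · have h' : 0 < d i := by omega
      simp [Int.sign_eq_one_of_pos h, h', h'.not_gt]
  simp only [hsum, Finset.prod_mul_distrib, ← Complex.exp_sum, ← Finset.sum_mul] at hprod
  rw [← Int.cast_sum, ← hsig] at hprod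
  set σ := matrixSignature A hHerm
  have hRpos : 0 < ∏ i, R i := Finset.prod_pos fun i _ => hR i
  rw [← Complex.ofReal_prod] at hprod
  have harg : (σ : ℂ) * (Real.pi * Complex.I / 4) = ((σ * (Real.pi / 4) : ℝ) : ℂ) * Complex.I := by
    push_cast
    ring
  rw [harg] at hprod
  have hnorm := congrArg norm hprod
  rw [norm_mul, Complex.norm_exp_ofReal_mul_I, Complex.norm_real, Real.norm_of_nonneg hRpos.le,
    mul_one, Complex.norm_natCast] at hnorm
  have hone : Complex.exp (((σ * (Real.pi / 4) : ℝ) : ℂ) * Complex.I) = 1 := by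
    have h1 : ((∏ i, R i : ℝ) : ℂ) = k := by rw [hnorm]; simp
    rw [h1] at hprod
    have hk' : (k : ℂ) ≠ 0 := by exact_mod_cast hk.ne'
    exact mul_left_cancel₀ hk' (by rw [hprod, mul_one])
  obtain ⟨m, hm⟩ := Complex.exp_eq_one_iff.1 hone
  refine ⟨m, ?_⟩
  have hπ : (Real.pi : ℂ) ≠ 0 := by exact_mod_cast Real.pi_ne_zero
  have h8 : (σ : ℂ) = 8 * m := by
    push_cast at hm
    have h1 : (σ : ℂ) * (Real.pi * Complex.I) = 8 * m * (Real.pi * Complex.I) := by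
      linear_combination 4 * hm
    exact mul_right_cancel₀ (mul_ne_zero hπ Complex.I_ne_zero) h1
  exact_mod_cast h8
end

section
/- Let T₁ = [[2,0,1],[0,2,1],[1,1,16]] and T₂ = [[4,0,0],[0,4,1],[0,1,4]]. Then for every prime p, the matrices T₁ and T₂ are congruent over the ring ℤ_p of p-adic integers: there exists a 3×3 matrix P over ℤ_p whose determinant is a unit of ℤ_p with Pᵀ · T₁ · P = T₂. (Together with their common positive definiteness, this says T₁ and T₂ lie in the same genus of positive definite even rank-3 lattices.) -/
open Matrix

/-- First transcendental lattice of the case `n = 55`, degeneration `10A₁`. -/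
def T1 : Matrix (Fin 3) (Fin 3) ℤ := !![2, 0, 1; 0, 2, 1; 1, 1, 16]

/-- Second transcendental lattice of the case `n = 55`, degeneration `10A₁`. -/
def T2 : Matrix (Fin 3) (Fin 3) ℤ := !![4, 0, 0; 0, 4, 1; 0, 1, 4]

/-- An integral similitude `Q` from `A` to `B` of ratio `d ^ 2` becomes a congruence, after
division by `d`, over any ring in which `d` and `det Q` are units. -/
theorem exists_congruence_of_similitude {n R : Type*} [Fintype n] [DecidableEq n] [CommRing R]
    {A B Q : Matrix n n ℤ} {d : ℤ} (hQ : Qᵀ * A * Q = d ^ 2 • B)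
    (hd : IsUnit (d : R)) (hdet : IsUnit (Q.det : R)) :
    ∃ P : Matrix n n R, IsUnit P.det ∧
      P.transpose * (A.map ((↑) : ℤ → R)) * P = B.map ((↑) : ℤ → R) := by
  obtain ⟨u, hu⟩ := hd
  refine ⟨(↑u⁻¹ : R) • Q.map ((↑) : ℤ → R), ?_, ?_⟩
  · rw [det_smul, ← Int.cast_det]
    exact (u⁻¹.isUnit.pow _).mul hdet
  · have h : (Q.map ((↑) : ℤ → R))ᵀ * A.map ((↑) : ℤ → R) * Q.map ((↑) : ℤ → R) =
        (u : R) ^ 2 • B.map ((↑) : ℤ → R) := by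
      have := congrArg (fun M : Matrix n n ℤ => M.map (Int.castRingHom R)) hQ
      simp only [Matrix.map_mul] at this
      ext i j
      simpa [hu, transpose_map, -zsmul_eq_mul] using congrFun (congrFun this i) j
    rw [transpose_smul, Matrix.smul_mul, Matrix.smul_mul, Matrix.mul_smul, h, smul_smul, smul_smul]
    have hu2 : (↑u⁻¹ : R) * (↑u⁻¹ * (u : R) ^ 2) = 1 := by
      rw [pow_two, Units.inv_mul_cancel_left, Units.inv_mul]
    rw [mul_assoc, hu2, one_smul]

/-- An integer prime to `p` is a unit in `ℤ_[p]`. -/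
theorem PadicInt.isUnit_intCast_of_not_dvd {p : ℕ} [Fact p.Prime] {k : ℤ} (h : ¬ (p : ℤ) ∣ k) :
    IsUnit (k : ℤ_[p]) := by
  rw [PadicInt.isUnit_iff]
  exact le_antisymm (PadicInt.norm_le_one _)
    (not_lt.mp fun hlt => h (PadicInt.norm_int_lt_one_iff_dvd k |>.mp hlt))

/-- `T₁` and `T₂` are congruent over the `p`-adic integers for every prime `p`
(i.e. they belong to the same genus). -/
theorem T1_T2_same_genus (p : ℕ) [Fact p.Prime] :
    ∃ P : Matrix (Fin 3) (Fin 3) (PadicInt p), IsUnit P.det ∧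
      P.transpose * (T1.map ((↑) : ℤ → PadicInt p)) * P =
        T2.map ((↑) : ℤ → PadicInt p) := by
  have hp : p.Prime := Fact.out
  by_cases h2 : p = 2
  · subst h2
    refine exists_congruence_of_similitude
      (Q := !![-7, 7, 0; -1, 2, 10; -2, -3, -1]) (d := 7) (by decide)
      (PadicInt.isUnit_intCast_of_not_dvd (by decide)) ?_
    exact PadicInt.isUnit_intCast_of_not_dvd (by simp [det_fin_three])
  · have h : ¬ (p : ℤ) ∣ 2 := fun h =>
      h2 ((Nat.prime_dvd_prime_iff_eq hp Nat.prime_two).mp (by exact_mod_cast h))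
    have hdet : (!![-2, 0, -2; -2, 1, 2; 0, -1, 0] : Matrix (Fin 3) (Fin 3) ℤ).det = -2 ^ 3 := by
      simp [det_fin_three]
    refine exists_congruence_of_similitude
      (Q := !![-2, 0, -2; -2, 1, 2; 0, -1, 0]) (d := 2) (by decide)
      (PadicInt.isUnit_intCast_of_not_dvd h) ?_
    rw [hdet]
    exact PadicInt.isUnit_intCast_of_not_dvd fun h' =>
      h ((Nat.prime_iff_prime_int.mp hp).dvd_of_dvd_pow (dvd_neg.mp h'))
end

section
/- Let A = diag(2, 4, 16) (the Gram matrix of the transcendental lattice ⟨2⟩ ⊕ ⟨4⟩ ⊕ ⟨16⟩ for the case n = 26, degeneration 8A₁). Then the orthogonal group O(A) = { P : 3×3 integer matrix | det P = ±1 and Pᵀ · A · P = A } has exactly 8 elements. -/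
open Matrix

/-- The integral isometries of `⟨2⟩ ⊕ ⟨4⟩ ⊕ ⟨16⟩` are the diagonal sign matrices. -/
theorem transpose_mul_diagonal_mul_eq_iff (P : Matrix (Fin 3) (Fin 3) ℤ) :
    P.transpose * diagonal ![2, 4, 16] * P = diagonal ![2, 4, 16] ↔
      ∃ v ∈ Fintype.piFinset fun _ : Fin 3 => ({1, -1} : Finset ℤ), diagonal v = P := by
  constructor
  · intro h
    have entry (i j : Fin 3) := congrFun (congrFun h i) j
    have h00 := entry 0 0
    have h01 := entry 0 1
    have h02 := entry 0 2
    have h11 := entry 1 1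
    have h12 := entry 1 2
    have h22 := entry 2 2
    simp [Matrix.mul_apply, Fin.sum_univ_three, diagonal_apply] at h00 h01 h02 h11 h12 h22
    have hb : P 1 0 = 0 := by
      by_contra hne
      nlinarith [sq_pos_of_ne_zero hne, sq_nonneg (P 0 0), sq_nonneg (P 2 0)]
    have hc : P 2 0 = 0 := by
      by_contra hne
      nlinarith [sq_pos_of_ne_zero hne, sq_nonneg (P 0 0), sq_nonneg (P 1 0)]
    have ha : P 0 0 = 1 ∨ P 0 0 = -1 :=
      mul_self_eq_one_iff.mp (by simp only [hb, hc] at h00; linarith)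
    have ha0 : P 0 0 ≠ 0 := by omega
    have hd : P 0 1 = 0 := by simpa [hb, hc, ha0] using h01
    have hg : P 0 2 = 0 := by simpa [hb, hc, ha0] using h02
    have hf : P 2 1 = 0 := by
      by_contra hne
      nlinarith [sq_pos_of_ne_zero hne, sq_nonneg (P 0 1), sq_nonneg (P 1 1)]
    have he : P 1 1 = 1 ∨ P 1 1 = -1 :=
      mul_self_eq_one_iff.mp (by simp only [hd, hf] at h11; linarith)
    have he0 : P 1 1 ≠ 0 := by omega
    have hk : P 1 2 = 0 := by simpa [hd, hf, he0] using h12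
    have hl : P 2 2 = 1 ∨ P 2 2 = -1 :=
      mul_self_eq_one_iff.mp (by simp only [hg, hk] at h22; linarith)
    refine ⟨fun i => P i i, ?_, ?_⟩
    · rw [Fintype.mem_piFinset]
      intro i
      fin_cases i <;> simpa
    · ext i j
      fin_cases i <;> fin_cases j <;> simp [hb, hc, hd, hf, hg, hk]
  · rintro ⟨v, hv, rfl⟩
    rw [diagonal_transpose, diagonal_mul_diagonal, diagonal_mul_diagonal]
    congr 1
    ext i
    have hi := Fintype.mem_piFinset.mp hv i
    rw [Finset.mem_insert, Finset.mem_singleton] at hi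
    rcases hi with hi | hi <;> simp [hi]

/-- The orthogonal group of the lattice `⟨2⟩ ⊕ ⟨4⟩ ⊕ ⟨16⟩` (case `n = 26`,
degeneration `8A₁`) has exactly `8` elements. -/
theorem orthogonal_group_card_n26_8A1 :
    {P : Matrix (Fin 3) (Fin 3) ℤ | (P.det = 1 ∨ P.det = -1) ∧
        P.transpose * Matrix.diagonal ![2, 4, 16] * P =
          Matrix.diagonal ![2, 4, 16]}.ncard = 8 := by
  have key : {P : Matrix (Fin 3) (Fin 3) ℤ | (P.det = 1 ∨ P.det = -1) ∧
        P.transpose * Matrix.diagonal ![2, 4, 16] * P = Matrix.diagonal ![2, 4, 16]} =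
      diagonal '' (Fintype.piFinset fun _ : Fin 3 => ({1, -1} : Finset ℤ) : Set (Fin 3 → ℤ)) := by
    ext P
    rw [Set.mem_ofPred_eq, transpose_mul_diagonal_mul_eq_iff, Set.mem_image]
    refine ⟨And.right, fun h => ⟨?_, h⟩⟩
    obtain ⟨v, hv, rfl⟩ := h
    rw [det_diagonal, ← Int.isUnit_iff, IsUnit.prod_univ_iff]
    intro i
    simpa [Int.isUnit_iff] using Fintype.mem_piFinset.mp hv i
  rw [key, Set.ncard_image_of_injective _ diagonal_injective, Set.ncard_coe_finset,
    Fintype.card_piFinset]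
  rfl
end
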